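/- In Ṽ, for all 1 ≤ i, k, u ≤ M+N−1 with k ≤ u, one has [I^±_{k,u}, X^∓_{i,0}] = 0 (the graded commutator of every element of I^±_{k,u} with X^∓_{i,0} vanishes). Consequently the subspaces Ṽ⁻Ṽ⁰Ṽ⁺I⁺Ṽ⁺ and Ṽ⁻I⁻Ṽ⁻Ṽ⁰Ṽ⁺ are two-sided ideals of Ṽ. -/

import Mathlib

noncomputable section

namespace QAS

open Polynomial
open scoped TensorProduct

/-! ### Basic combinatorial data -/

/-- `l_i = 1` for `i ≤ M`, `-1` otherwise. -/
def lof (M : ℕ) (i : ℕ) : ℤ := if i ≤ M then 1 else -1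

/-- the bilinear form `(ε_i, ε_j) = l_i δ_{ij}`. -/
def innerE (M : ℕ) (i j : ℕ) : ℤ := if i = j then lof M i else 0

/-- `(ε_a − ε_b, ε_c − ε_d)`. -/
def form4 (M : ℕ) (a b c d : ℕ) : ℤ :=
  innerE M a c - innerE M a d - innerE M b c + innerE M b d

/-- the Cartan pairing `c_{ij} = (ε_i − ε_{i+1}, ε_j − ε_{j+1})`. -/
def cc (M : ℕ) (i j : ℕ) : ℤ := form4 M i (i + 1) j (j + 1)

/-- `q_i = q^{l_i}`. -/
def qpar (q : ℂ) (M : ℕ) (i : ℕ) : ℂ := q ^ lof M i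

/-- the quantum integer `[m]_v`. -/
def qint (v : ℂ) (m : ℤ) : ℂ := (v ^ m - v ^ (-m)) / (v - v⁻¹)

/-- the sign `(−1)^{|X_i||X_j|}` for the generators `X_i`, `X_j`. -/
def sgn (M : ℕ) (i j : ℕ) : ℂ := if i = M ∧ j = M then -1 else 1

/-- index set `1 ≤ i ≤ M+N−1`. -/
abbrev Idx (M N : ℕ) := {i : ℕ // 1 ≤ i ∧ i ≤ M + N - 1}

/-! ### Generators and the free superalgebra -/

/-- Drinfel'd generators; when `ext = true` we also have `K₀^{±1}`. -/
inductive Gen (M N : ℕ) (ext : Bool) : Type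
  | Xp : Idx M N → ℤ → Gen M N ext
  | Xm : Idx M N → ℤ → Gen M N ext
  | K : Idx M N → Gen M N ext
  | Ki : Idx M N → Gen M N ext
  | H : Idx M N → {s : ℤ // s ≠ 0} → Gen M N ext
  | K0 : ext = true → Gen M N ext
  | K0i : ext = true → Gen M N ext

abbrev FA (M N : ℕ) (ext : Bool) := FreeAlgebra ℂ (Gen M N ext)

def gi {M N : ℕ} {ext : Bool} (g : Gen M N ext) : FA M N ext := FreeAlgebra.ι ℂ g

def XpF (M N : ℕ) (ext : Bool) (i : ℕ) (n : ℤ) : FA M N ext :=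
  if h : 1 ≤ i ∧ i ≤ M + N - 1 then gi (Gen.Xp ⟨i, h⟩ n) else 0

def XmF (M N : ℕ) (ext : Bool) (i : ℕ) (n : ℤ) : FA M N ext :=
  if h : 1 ≤ i ∧ i ≤ M + N - 1 then gi (Gen.Xm ⟨i, h⟩ n) else 0

def KF (M N : ℕ) (ext : Bool) (i : ℕ) : FA M N ext :=
  if h : 1 ≤ i ∧ i ≤ M + N - 1 then gi (Gen.K ⟨i, h⟩) else 0

def KiF (M N : ℕ) (ext : Bool) (i : ℕ) : FA M N ext :=
  if h : 1 ≤ i ∧ i ≤ M + N - 1 then gi (Gen.Ki ⟨i, h⟩) else 0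

def HF (M N : ℕ) (ext : Bool) (i : ℕ) (s : ℤ) : FA M N ext :=
  if h : (1 ≤ i ∧ i ≤ M + N - 1) ∧ s ≠ 0 then gi (Gen.H ⟨i, h.1⟩ ⟨s, h.2⟩) else 0

def K0F (M N : ℕ) (ext : Bool) : FA M N ext :=
  if h : ext = true then gi (Gen.K0 h) else 0

def K0iF (M N : ℕ) (ext : Bool) : FA M N ext :=
  if h : ext = true then gi (Gen.K0i h) else 0

/-- coefficients of `exp (t · Σ_{s ≥ 1} a_s z^s)`. -/
def expC {A : Type} [Ring A] [Algebra ℂ A] (t : ℂ) (a : ℕ → A) : ℕ → A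
  | 0 => 1
  | n + 1 =>
      ((n : ℂ) + 1)⁻¹ •
        (t • ∑ s ∈ Finset.range (n + 1), ((s : ℂ) + 1) • (a (s + 1) * expC t a (n - s)))
termination_by n => n
decreasing_by omega

/-- `φ⁺_{i,n}`, the coefficient of `z^n` in
`K_i exp((q_i − q_i⁻¹) Σ_{s>0} h_{i,s} z^s)`. -/
def phiPF (q : ℂ) (M N : ℕ) (ext : Bool) (i : ℕ) (n : ℤ) : FA M N ext :=
  if 0 ≤ n then
    KF M N ext i *
      expC (qpar q M i - (qpar q M i)⁻¹) (fun s => HF M N ext i (s : ℤ)) n.toNat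
  else 0

/-- `φ⁻_{i,n}`, the coefficient of `z^n` (`n ≤ 0`) in
`K_i⁻¹ exp(−(q_i − q_i⁻¹) Σ_{s>0} h_{i,−s} z^{−s})`. -/
def phiMF (q : ℂ) (M N : ℕ) (ext : Bool) (i : ℕ) (n : ℤ) : FA M N ext :=
  if n ≤ 0 then
    KiF M N ext i *
      expC (-(qpar q M i - (qpar q M i)⁻¹)) (fun s => HF M N ext i (-(s : ℤ))) (-n).toNat
  else 0

/-- the `u`-bracket `[x,y]_u = xy − u·yx` (for `x` or `y` of even parity). -/
def brF {A : Type} [Ring A] [Module ℂ A] (u : ℂ) (x y : A) : A := x * y - u • (y * x)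

/-- the quartic oscillation expression
`[[[X_{M−1,m}, X_{M,n}]_{q⁻¹}, X_{M+1,k}]_q, X_{M,u}]` (a graded anticommutator in the
outermost bracket, both entries being odd). -/
def oscOf {A : Type} [Ring A] [Module ℂ A] (q : ℂ) (M : ℕ) (X : ℕ → ℤ → A) (m n k u : ℤ) : A :=
  brF q (brF q⁻¹ (X (M - 1) m) (X M n)) (X (M + 1) k) * X M u +
    X M u * brF q (brF q⁻¹ (X (M - 1) m) (X M n)) (X (M + 1) k)

/-! ### The defining relations.
`lvl = 1`: only (R1)–(R3);  `lvl = 2`: (R1)–(R5);  `lvl = 3`: all of (R1)–(R7).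
`ext = true` adds `K₀^{±1}` together with its relations. -/

inductive rel (q : ℂ) (M N : ℕ) (ext : Bool) (lvl : ℕ) : FA M N ext → FA M N ext → Prop
  | KKi (i : Idx M N) : rel q M N ext lvl (gi (Gen.K i) * gi (Gen.Ki i)) 1
  | KiK (i : Idx M N) : rel q M N ext lvl (gi (Gen.Ki i) * gi (Gen.K i)) 1
  | KK (i j : Idx M N) :
      rel q M N ext lvl (gi (Gen.K i) * gi (Gen.K j)) (gi (Gen.K j) * gi (Gen.K i))
  | KKi2 (i j : Idx M N) :
      rel q M N ext lvl (gi (Gen.K i) * gi (Gen.Ki j)) (gi (Gen.Ki j) * gi (Gen.K i))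
  | KiKi (i j : Idx M N) :
      rel q M N ext lvl (gi (Gen.Ki i) * gi (Gen.Ki j)) (gi (Gen.Ki j) * gi (Gen.Ki i))
  | KH (i j : Idx M N) (s : {s : ℤ // s ≠ 0}) :
      rel q M N ext lvl (gi (Gen.K i) * gi (Gen.H j s)) (gi (Gen.H j s) * gi (Gen.K i))
  | KiH (i j : Idx M N) (s : {s : ℤ // s ≠ 0}) :
      rel q M N ext lvl (gi (Gen.Ki i) * gi (Gen.H j s)) (gi (Gen.H j s) * gi (Gen.Ki i))
  | HH (i j : Idx M N) (s t : {s : ℤ // s ≠ 0}) :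
      rel q M N ext lvl (gi (Gen.H i s) * gi (Gen.H j t)) (gi (Gen.H j t) * gi (Gen.H i s))
  | KXp (i j : Idx M N) (n : ℤ) :
      rel q M N ext lvl (gi (Gen.K i) * gi (Gen.Xp j n))
        ((q ^ cc M i.1 j.1) • (gi (Gen.Xp j n) * gi (Gen.K i)))
  | KXm (i j : Idx M N) (n : ℤ) :
      rel q M N ext lvl (gi (Gen.K i) * gi (Gen.Xm j n))
        ((q ^ (-cc M i.1 j.1)) • (gi (Gen.Xm j n) * gi (Gen.K i)))
  | HXp (i j : Idx M N) (s : {s : ℤ // s ≠ 0}) (n : ℤ) :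
      rel q M N ext lvl
        (gi (Gen.H i s) * gi (Gen.Xp j n) - gi (Gen.Xp j n) * gi (Gen.H i s))
        ((qint (qpar q M i.1) (s.1 * lof M i.1 * cc M i.1 j.1) / (s.1 : ℂ)) •
          gi (Gen.Xp j (n + s.1)))
  | HXm (i j : Idx M N) (s : {s : ℤ // s ≠ 0}) (n : ℤ) :
      rel q M N ext lvl
        (gi (Gen.H i s) * gi (Gen.Xm j n) - gi (Gen.Xm j n) * gi (Gen.H i s))
        (-((qint (qpar q M i.1) (s.1 * lof M i.1 * cc M i.1 j.1) / (s.1 : ℂ)) •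
          gi (Gen.Xm j (n + s.1))))
  | XpXm (i j : Idx M N) (m n : ℤ) :
      rel q M N ext lvl
        (gi (Gen.Xp i m) * gi (Gen.Xm j n) -
          sgn M i.1 j.1 • (gi (Gen.Xm j n) * gi (Gen.Xp i m)))
        (if i = j then
            (qpar q M i.1 - (qpar q M i.1)⁻¹)⁻¹ •
              (phiPF q M N ext i.1 (m + n) - phiMF q M N ext i.1 (m + n))
          else 0)
  | XX0p (i j : Idx M N) (m n : ℤ) (h2 : 2 ≤ lvl) (h : cc M i.1 j.1 = 0) :
      rel q M N ext lvl
        (gi (Gen.Xp i m) * gi (Gen.Xp j n) -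
          sgn M i.1 j.1 • (gi (Gen.Xp j n) * gi (Gen.Xp i m))) 0
  | XX0m (i j : Idx M N) (m n : ℤ) (h2 : 2 ≤ lvl) (h : cc M i.1 j.1 = 0) :
      rel q M N ext lvl
        (gi (Gen.Xm i m) * gi (Gen.Xm j n) -
          sgn M i.1 j.1 • (gi (Gen.Xm j n) * gi (Gen.Xm i m))) 0
  | XXp (i j : Idx M N) (m n : ℤ) (h2 : 2 ≤ lvl) (h : cc M i.1 j.1 ≠ 0) :
      rel q M N ext lvl
        (gi (Gen.Xp i (m + 1)) * gi (Gen.Xp j n) -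
          (q ^ cc M i.1 j.1) • (gi (Gen.Xp j n) * gi (Gen.Xp i (m + 1))))
        ((q ^ cc M i.1 j.1) • (gi (Gen.Xp i m) * gi (Gen.Xp j (n + 1))) -
          gi (Gen.Xp j (n + 1)) * gi (Gen.Xp i m))
  | XXm (i j : Idx M N) (m n : ℤ) (h2 : 2 ≤ lvl) (h : cc M i.1 j.1 ≠ 0) :
      rel q M N ext lvl
        (gi (Gen.Xm i (m + 1)) * gi (Gen.Xm j n) -
          (q ^ (-cc M i.1 j.1)) • (gi (Gen.Xm j n) * gi (Gen.Xm i (m + 1))))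
        ((q ^ (-cc M i.1 j.1)) • (gi (Gen.Xm i m) * gi (Gen.Xm j (n + 1))) -
          gi (Gen.Xm j (n + 1)) * gi (Gen.Xm i m))
  | serreP (i j : Idx M N) (m n k : ℤ) (h3 : 3 ≤ lvl)
      (h : cc M i.1 j.1 = 1 ∨ cc M i.1 j.1 = -1) (hi : i.1 ≠ M) :
      rel q M N ext lvl
        (brF q (gi (Gen.Xp i m)) (brF q⁻¹ (gi (Gen.Xp i n)) (gi (Gen.Xp j k))) +
          brF q (gi (Gen.Xp i n)) (brF q⁻¹ (gi (Gen.Xp i m)) (gi (Gen.Xp j k)))) 0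
  | serreM (i j : Idx M N) (m n k : ℤ) (h3 : 3 ≤ lvl)
      (h : cc M i.1 j.1 = 1 ∨ cc M i.1 j.1 = -1) (hi : i.1 ≠ M) :
      rel q M N ext lvl
        (brF q (gi (Gen.Xm i m)) (brF q⁻¹ (gi (Gen.Xm i n)) (gi (Gen.Xm j k))) +
          brF q (gi (Gen.Xm i n)) (brF q⁻¹ (gi (Gen.Xm i m)) (gi (Gen.Xm j k)))) 0
  | oscP (m n k u : ℤ) (h3 : 3 ≤ lvl) (hM : 1 < M) (hN : 1 < N) :
      rel q M N ext lvl
        (oscOf q M (XpF M N ext) m n k u + oscOf q M (XpF M N ext) m u k n) 0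
  | oscM (m n k u : ℤ) (h3 : 3 ≤ lvl) (hM : 1 < M) (hN : 1 < N) :
      rel q M N ext lvl
        (oscOf q M (XmF M N ext) m n k u + oscOf q M (XmF M N ext) m u k n) 0
  | K0K0i (he : ext = true) : rel q M N ext lvl (gi (Gen.K0 he) * gi (Gen.K0i he)) 1
  | K0iK0 (he : ext = true) : rel q M N ext lvl (gi (Gen.K0i he) * gi (Gen.K0 he)) 1
  | K0K (he : ext = true) (i : Idx M N) :
      rel q M N ext lvl (gi (Gen.K0 he) * gi (Gen.K i)) (gi (Gen.K i) * gi (Gen.K0 he))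
  | K0Ki (he : ext = true) (i : Idx M N) :
      rel q M N ext lvl (gi (Gen.K0 he) * gi (Gen.Ki i)) (gi (Gen.Ki i) * gi (Gen.K0 he))
  | K0H (he : ext = true) (i : Idx M N) (s : {s : ℤ // s ≠ 0}) :
      rel q M N ext lvl (gi (Gen.K0 he) * gi (Gen.H i s)) (gi (Gen.H i s) * gi (Gen.K0 he))
  | K0Xp (he : ext = true) (i : Idx M N) (n : ℤ) :
      rel q M N ext lvl (gi (Gen.K0 he) * gi (Gen.Xp i n))
        ((q ^ (if i.1 = 1 then (1 : ℤ) else 0)) • (gi (Gen.Xp i n) * gi (Gen.K0 he)))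
  | K0Xm (he : ext = true) (i : Idx M N) (n : ℤ) :
      rel q M N ext lvl (gi (Gen.K0 he) * gi (Gen.Xm i n))
        ((q ^ (if i.1 = 1 then (-1 : ℤ) else 0)) • (gi (Gen.Xm i n) * gi (Gen.K0 he)))

/-! ### The quantum affine superalgebras -/

abbrev ALG (q : ℂ) (M N : ℕ) (ext : Bool) (lvl : ℕ) := RingQuot (rel q M N ext lvl)

def mkA (q : ℂ) (M N : ℕ) (ext : Bool) (lvl : ℕ) : FA M N ext →ₐ[ℂ] ALG q M N ext lvl :=
  RingQuot.mkAlgHom ℂ (rel q M N ext lvl)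

def XpA (q : ℂ) (M N : ℕ) (ext : Bool) (lvl : ℕ) (i : ℕ) (n : ℤ) : ALG q M N ext lvl :=
  mkA q M N ext lvl (XpF M N ext i n)

def XmA (q : ℂ) (M N : ℕ) (ext : Bool) (lvl : ℕ) (i : ℕ) (n : ℤ) : ALG q M N ext lvl :=
  mkA q M N ext lvl (XmF M N ext i n)

def KA (q : ℂ) (M N : ℕ) (ext : Bool) (lvl : ℕ) (i : ℕ) : ALG q M N ext lvl :=
  mkA q M N ext lvl (KF M N ext i)

def KiA (q : ℂ) (M N : ℕ) (ext : Bool) (lvl : ℕ) (i : ℕ) : ALG q M N ext lvl :=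
  mkA q M N ext lvl (KiF M N ext i)

def HA (q : ℂ) (M N : ℕ) (ext : Bool) (lvl : ℕ) (i : ℕ) (s : ℤ) : ALG q M N ext lvl :=
  mkA q M N ext lvl (HF M N ext i s)

def K0A (q : ℂ) (M N : ℕ) (ext : Bool) (lvl : ℕ) : ALG q M N ext lvl :=
  mkA q M N ext lvl (K0F M N ext)

def K0iA (q : ℂ) (M N : ℕ) (ext : Bool) (lvl : ℕ) : ALG q M N ext lvl :=
  mkA q M N ext lvl (K0iF M N ext)

def phiPA (q : ℂ) (M N : ℕ) (ext : Bool) (lvl : ℕ) (i : ℕ) (n : ℤ) : ALG q M N ext lvl :=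
  mkA q M N ext lvl (phiPF q M N ext i n)

def phiMA (q : ℂ) (M N : ℕ) (ext : Bool) (lvl : ℕ) (i : ℕ) (n : ℤ) : ALG q M N ext lvl :=
  mkA q M N ext lvl (phiMF q M N ext i n)

/-- `U⁺`: the subalgebra generated by the `X⁺_{i,n}`. -/
def Aplus (q : ℂ) (M N : ℕ) (ext : Bool) (lvl : ℕ) : Subalgebra ℂ (ALG q M N ext lvl) :=
  Algebra.adjoin ℂ {x | ∃ i : ℕ, ∃ n : ℤ, x = XpA q M N ext lvl i n}

/-- `U⁻`: the subalgebra generated by the `X⁻_{i,n}`. -/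
def Aminus (q : ℂ) (M N : ℕ) (ext : Bool) (lvl : ℕ) : Subalgebra ℂ (ALG q M N ext lvl) :=
  Algebra.adjoin ℂ {x | ∃ i : ℕ, ∃ n : ℤ, x = XmA q M N ext lvl i n}

/-- `U⁰`: the subalgebra generated by the `K_i^{±1}` and `h_{i,s}`. -/
def Azero (q : ℂ) (M N : ℕ) (ext : Bool) (lvl : ℕ) : Subalgebra ℂ (ALG q M N ext lvl) :=
  Algebra.adjoin ℂ {x | (∃ i : ℕ, x = KA q M N ext lvl i) ∨ (∃ i : ℕ, x = KiA q M N ext lvl i) ∨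
    ∃ i : ℕ, ∃ s : ℤ, x = HA q M N ext lvl i s}

/-- `U'⁰`: the subalgebra generated by `U⁰` and `K₀^{±1}`. -/
def AzeroE (q : ℂ) (M N : ℕ) (ext : Bool) (lvl : ℕ) : Subalgebra ℂ (ALG q M N ext lvl) :=
  Algebra.adjoin ℂ {x | (∃ i : ℕ, x = KA q M N ext lvl i) ∨ (∃ i : ℕ, x = KiA q M N ext lvl i) ∨
    (∃ i : ℕ, ∃ s : ℤ, x = HA q M N ext lvl i s) ∨ x = K0A q M N ext lvl ∨
      x = K0iA q M N ext lvl}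

/-! ### The multiplication map on the triple tensor product -/

def triMul (q : ℂ) (M N : ℕ) (ext : Bool) (lvl : ℕ)
    (S T R : Subalgebra ℂ (ALG q M N ext lvl)) :
    (↥S ⊗[ℂ] (↥T ⊗[ℂ] ↥R)) →ₗ[ℂ] ALG q M N ext lvl :=
  TensorProduct.lift
    (((LinearMap.mul ℂ (ALG q M N ext lvl)).comp S.val.toLinearMap).compl₂
      (TensorProduct.lift
        (((LinearMap.mul ℂ (ALG q M N ext lvl)).comp T.val.toLinearMap).compl₂
          R.val.toLinearMap)))

/-! ### Root vectors and PBW monomials -/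

def Xroot (q : ℂ) (M N : ℕ) (ext : Bool) (lvl : ℕ) (i : ℕ) : ℕ → ℤ → ALG q M N ext lvl
  | 0, n => XpA q M N ext lvl i n
  | k + 1, n =>
      brF (qpar q M (i + k + 1)) (Xroot q M N ext lvl i k n) (XpA q M N ext lvl (i + k + 1) 0)

/-- the root vector `X_{α_i + ⋯ + α_j}(n)`. -/
def XrootIJ (q : ℂ) (M N : ℕ) (ext : Bool) (lvl : ℕ) (i j : ℕ) (n : ℤ) : ALG q M N ext lvl :=
  Xroot q M N ext lvl i (j - i) n

def rootLE (a b : ℕ × ℕ) : Prop := a.1 < b.1 ∨ (a.1 = b.1 ∧ a.2 ≤ b.2)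

/-- the set of PBW ordered monomials in the root vectors. -/
def pbwSet (q : ℂ) (M N : ℕ) (ext : Bool) (lvl : ℕ) : Set (ALG q M N ext lvl) :=
  {x | ∃ L : List ((ℕ × ℕ) × ℤ),
      (∀ p ∈ L, 1 ≤ p.1.1 ∧ p.1.1 ≤ p.1.2 ∧ p.1.2 ≤ M + N - 1) ∧
      L.Chain' (fun a b => rootLE a.1 b.1) ∧
      x = (L.map fun p => XrootIJ q M N ext lvl p.1.1 p.1.2 p.2).prod}

/-- PBW ordered monomials of total degree `d` (`d i` counts the multiplicity of `α_i`). -/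
def pbwDegSet (q : ℂ) (M N : ℕ) (ext : Bool) (lvl : ℕ) (d : ℕ → ℕ) : Set (ALG q M N ext lvl) :=
  {x | ∃ L : List ((ℕ × ℕ) × ℤ),
      (∀ p ∈ L, 1 ≤ p.1.1 ∧ p.1.1 ≤ p.1.2 ∧ p.1.2 ≤ M + N - 1) ∧
      L.Chain' (fun a b => rootLE a.1 b.1) ∧
      (∀ i : ℕ, ((L.map fun p => if p.1.1 ≤ i ∧ i ≤ p.1.2 then 1 else 0).sum) = d i) ∧
      x = (L.map fun p => XrootIJ q M N ext lvl p.1.1 p.1.2 p.2).prod}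

/-- words in the generators `X⁺_{i,n}` of degree `d`. -/
def wordDegSet (q : ℂ) (M N : ℕ) (ext : Bool) (lvl : ℕ) (d : ℕ → ℕ) :
    Set (ALG q M N ext lvl) :=
  {x | ∃ w : List (ℕ × ℤ), (∀ p ∈ w, 1 ≤ p.1 ∧ p.1 ≤ M + N - 1) ∧
      (∀ i : ℕ, (w.map Prod.fst).count i = d i) ∧
      x = (w.map fun p => XpA q M N ext lvl p.1 p.2).prod}

/-! ### The subspaces `I^±_{i,j}` and `O^±` -/

def IElt (q : ℂ) (M N : ℕ) (ext : Bool) (lvl : ℕ) (pl : Bool) (i j : ℕ) (m n : ℤ) :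
    ALG q M N ext lvl :=
  let X : ℕ → ℤ → ALG q M N ext lvl := if pl then XpA q M N ext lvl else XmA q M N ext lvl
  let e : ℤ := if pl then cc M i j else -cc M i j
  if cc M i j = 0 then X i m * X j n - sgn M i j • (X j n * X i m)
  else
    X i (m + 1) * X j n - (q ^ e) • (X j n * X i (m + 1)) -
      (q ^ e) • (X i m * X j (n + 1)) + X j (n + 1) * X i m

def Isub (q : ℂ) (M N : ℕ) (ext : Bool) (lvl : ℕ) (pl : Bool) (i j : ℕ) :
    Submodule ℂ (ALG q M N ext lvl) :=
  Submodule.span ℂ (Set.range fun p : ℤ × ℤ => IElt q M N ext lvl pl i j p.1 p.2)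

def IsubAll (q : ℂ) (M N : ℕ) (ext : Bool) (lvl : ℕ) (pl : Bool) :
    Submodule ℂ (ALG q M N ext lvl) :=
  ⨆ p : ℕ × ℕ, ⨆ _ : 1 ≤ p.1 ∧ p.1 ≤ p.2 ∧ p.2 ≤ M + N - 1,
    Isub q M N ext lvl pl p.1 p.2

def OscElt (q : ℂ) (M N : ℕ) (ext : Bool) (lvl : ℕ) (pl : Bool) (m n k u : ℤ) :
    ALG q M N ext lvl :=
  let X : ℕ → ℤ → ALG q M N ext lvl := if pl then XpA q M N ext lvl else XmA q M N ext lvl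
  oscOf q M X m n k u + oscOf q M X m u k n

def Osub (q : ℂ) (M N : ℕ) (ext : Bool) (lvl : ℕ) (pl : Bool) :
    Submodule ℂ (ALG q M N ext lvl) :=
  Submodule.span ℂ
    (Set.range fun p : ℤ × ℤ × ℤ × ℤ => OscElt q M N ext lvl pl p.1 p.2.1 p.2.2.1 p.2.2.2)

/-- the sign `(−1)^{(p(α_k)+p(α_u))·p(α_i)}`. -/
def gsgn (M : ℕ) (k u i : ℕ) : ℂ :=
  if ((k = M ∧ ¬u = M) ∨ (¬k = M ∧ u = M)) ∧ i = M then -1 else 1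

/-! ### Highest weights and the associated eigenvalue sequences -/

/-- `Q·f = 0` for a bilateral formal series `f`. -/
def annih (Q : Polynomial ℂ) (f : ℤ → ℂ) : Prop :=
  ∀ n : ℤ, ∑ s ∈ Finset.range (Q.natDegree + 1), Q.coeff s * f (n - s) = 0

/-- an element of `R_{M,N}`: a highest weight `(P̲, f, c)`. -/
structure HW (q : ℂ) (M N : ℕ) : Type where
  P : ℕ → Polynomial ℂ
  f : ℤ → ℂ
  c : ℂ
  P_const : ∀ i, (P i).coeff 0 = 1
  c_ne : c ≠ 0
  torsion : ∃ Q : Polynomial ℂ, Q ≠ 0 ∧ annih Q f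
  f_zero : f 0 = (c - c⁻¹) / (q - q⁻¹)

def toPS (p : Polynomial ℂ) : PowerSeries ℂ := PowerSeries.mk fun n => p.coeff n

/-- `P(z·u)`. -/
def pscale (u : ℂ) (P : Polynomial ℂ) : Polynomial ℂ := P.comp (Polynomial.C u * Polynomial.X)

/-- the coefficient of `z^n` (`n ≥ 0`) in `q_i^{deg P} P(z q_i⁻¹)/P(z q_i)`,
expanded at `z = 0`. -/
def gammaP (q : ℂ) (M : ℕ) (i : ℕ) (P : Polynomial ℂ) (n : ℤ) : ℂ :=
  if 0 ≤ n then
    qpar q M i ^ P.natDegree *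
      PowerSeries.coeff n.toNat
        (toPS (pscale (qpar q M i)⁻¹ P) * (toPS (pscale (qpar q M i) P))⁻¹)
  else 0

/-- the coefficient of `z^n` (`n ≤ 0`) in `q_i^{deg P} P(z q_i⁻¹)/P(z q_i)`,
expanded at `z = ∞`. -/
def gammaM (q : ℂ) (M : ℕ) (i : ℕ) (P : Polynomial ℂ) (n : ℤ) : ℂ :=
  if n ≤ 0 then
    qpar q M i ^ P.natDegree *
      PowerSeries.coeff (-n).toNat
        (toPS ((pscale (qpar q M i)⁻¹ P).reflect P.natDegree) *
          (toPS ((pscale (qpar q M i) P).reflect P.natDegree))⁻¹)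
  else 0

/-! ### Verma, Weyl and simple modules -/

def vermaRels (q : ℂ) (M N : ℕ) (ext : Bool) (Λ : HW q M N) : Set (ALG q M N ext 3) :=
  {x | ∃ i : ℕ, ∃ n : ℤ, x = XpA q M N ext 3 i n} ∪
  {x | ∃ i : ℕ, ∃ n : ℤ, 1 ≤ i ∧ i ≤ M + N - 1 ∧ i ≠ M ∧
      (x = phiPA q M N ext 3 i n - algebraMap ℂ _ (gammaP q M i (Λ.P i) n) ∨
       x = phiMA q M N ext 3 i n - algebraMap ℂ _ (gammaM q M i (Λ.P i) n))} ∪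
  {x | x = KA q M N ext 3 M - algebraMap ℂ _ Λ.c} ∪
  {x | ∃ n : ℤ, x = phiPA q M N ext 3 M n - phiMA q M N ext 3 M n -
      algebraMap ℂ _ ((q - q⁻¹) * Λ.f n)} ∪
  {x | ext = true ∧ x = K0A q M N ext 3 - 1}

def evenRels (q : ℂ) (M N : ℕ) (ext : Bool) (Λ : HW q M N) : Set (ALG q M N ext 3) :=
  {x | ∃ i : ℕ, 1 ≤ i ∧ i ≤ M + N - 1 ∧ i ≠ M ∧
      x = XmA q M N ext 3 i 0 ^ (1 + (Λ.P i).natDegree)}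

def oddElt (q : ℂ) (M N : ℕ) (ext : Bool) (Q : Polynomial ℂ) (n : ℤ) : ALG q M N ext 3 :=
  ∑ s ∈ Finset.range (Q.natDegree + 1),
    Q.coeff (Q.natDegree - s) • XmA q M N ext 3 M ((s : ℤ) + n)

def oddRels (q : ℂ) (M N : ℕ) (ext : Bool) (Q : Polynomial ℂ) : Set (ALG q M N ext 3) :=
  if M = 1 ∧ N = 1 then {x | ∃ n : ℤ, x = oddElt q M N ext Q n}
  else {oddElt q M N ext Q 0}

def vermaIdeal (q : ℂ) (M N : ℕ) (ext : Bool) (Λ : HW q M N) : Ideal (ALG q M N ext 3) :=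
  Ideal.span (vermaRels q M N ext Λ)

def weylIdeal (q : ℂ) (M N : ℕ) (ext : Bool) (Λ : HW q M N) (Q : Polynomial ℂ) :
    Ideal (ALG q M N ext 3) :=
  Ideal.span (vermaRels q M N ext Λ ∪ evenRels q M N ext Λ ∪ oddRels q M N ext Q)

def uweylIdeal (q : ℂ) (M N : ℕ) (ext : Bool) (Λ : HW q M N) : Ideal (ALG q M N ext 3) :=
  Ideal.span (vermaRels q M N ext Λ ∪ evenRels q M N ext Λ)

/-- the Verma module `M(Λ)`. -/
def VermaMod (q : ℂ) (M N : ℕ) (ext : Bool) (Λ : HW q M N) : Type :=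
  ALG q M N ext 3 ⧸ vermaIdeal q M N ext Λ

/-- the Weyl module `W(Λ; Q)`. -/
def WeylMod (q : ℂ) (M N : ℕ) (ext : Bool) (Λ : HW q M N) (Q : Polynomial ℂ) : Type :=
  ALG q M N ext 3 ⧸ weylIdeal q M N ext Λ Q

/-- the universal Weyl module `W(Λ)`. -/
def UWeylMod (q : ℂ) (M N : ℕ) (ext : Bool) (Λ : HW q M N) : Type :=
  ALG q M N ext 3 ⧸ uweylIdeal q M N ext Λ

instance (q : ℂ) (M N : ℕ) (ext : Bool) (Λ : HW q M N) : AddCommGroup (VermaMod q M N ext Λ) :=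
  inferInstanceAs (AddCommGroup (ALG q M N ext 3 ⧸ vermaIdeal q M N ext Λ))
instance (q : ℂ) (M N : ℕ) (ext : Bool) (Λ : HW q M N) :
    Module (ALG q M N ext 3) (VermaMod q M N ext Λ) :=
  inferInstanceAs (Module (ALG q M N ext 3) (ALG q M N ext 3 ⧸ vermaIdeal q M N ext Λ))
instance (q : ℂ) (M N : ℕ) (ext : Bool) (Λ : HW q M N) : Module ℂ (VermaMod q M N ext Λ) :=
  inferInstanceAs (Module ℂ (ALG q M N ext 3 ⧸ vermaIdeal q M N ext Λ))
instance (q : ℂ) (M N : ℕ) (ext : Bool) (Λ : HW q M N) :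
    IsScalarTower ℂ (ALG q M N ext 3) (VermaMod q M N ext Λ) :=
  inferInstanceAs (IsScalarTower ℂ (ALG q M N ext 3) (ALG q M N ext 3 ⧸ vermaIdeal q M N ext Λ))

instance (q : ℂ) (M N : ℕ) (ext : Bool) (Λ : HW q M N) (Q : Polynomial ℂ) :
    AddCommGroup (WeylMod q M N ext Λ Q) :=
  inferInstanceAs (AddCommGroup (ALG q M N ext 3 ⧸ weylIdeal q M N ext Λ Q))
instance (q : ℂ) (M N : ℕ) (ext : Bool) (Λ : HW q M N) (Q : Polynomial ℂ) :
    Module (ALG q M N ext 3) (WeylMod q M N ext Λ Q) :=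
  inferInstanceAs (Module (ALG q M N ext 3) (ALG q M N ext 3 ⧸ weylIdeal q M N ext Λ Q))
instance (q : ℂ) (M N : ℕ) (ext : Bool) (Λ : HW q M N) (Q : Polynomial ℂ) :
    Module ℂ (WeylMod q M N ext Λ Q) :=
  inferInstanceAs (Module ℂ (ALG q M N ext 3 ⧸ weylIdeal q M N ext Λ Q))
instance (q : ℂ) (M N : ℕ) (ext : Bool) (Λ : HW q M N) (Q : Polynomial ℂ) :
    IsScalarTower ℂ (ALG q M N ext 3) (WeylMod q M N ext Λ Q) :=
  inferInstanceAs
    (IsScalarTower ℂ (ALG q M N ext 3) (ALG q M N ext 3 ⧸ weylIdeal q M N ext Λ Q))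

instance (q : ℂ) (M N : ℕ) (ext : Bool) (Λ : HW q M N) : AddCommGroup (UWeylMod q M N ext Λ) :=
  inferInstanceAs (AddCommGroup (ALG q M N ext 3 ⧸ uweylIdeal q M N ext Λ))
instance (q : ℂ) (M N : ℕ) (ext : Bool) (Λ : HW q M N) :
    Module (ALG q M N ext 3) (UWeylMod q M N ext Λ) :=
  inferInstanceAs (Module (ALG q M N ext 3) (ALG q M N ext 3 ⧸ uweylIdeal q M N ext Λ))
instance (q : ℂ) (M N : ℕ) (ext : Bool) (Λ : HW q M N) : Module ℂ (UWeylMod q M N ext Λ) :=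
  inferInstanceAs (Module ℂ (ALG q M N ext 3 ⧸ uweylIdeal q M N ext Λ))
instance (q : ℂ) (M N : ℕ) (ext : Bool) (Λ : HW q M N) :
    IsScalarTower ℂ (ALG q M N ext 3) (UWeylMod q M N ext Λ) :=
  inferInstanceAs (IsScalarTower ℂ (ALG q M N ext 3) (ALG q M N ext 3 ⧸ uweylIdeal q M N ext Λ))

/-- the highest weight vector (image of `1`). -/
def vgen (q : ℂ) (M N : ℕ) (Λ : HW q M N) : VermaMod q M N true Λ :=
  Submodule.Quotient.mk 1

/-- the sum of all submodules not containing the highest weight vector (the unique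
maximal submodule of the Verma module). -/
def radV (q : ℂ) (M N : ℕ) (Λ : HW q M N) :
    Submodule (ALG q M N true 3) (VermaMod q M N true Λ) :=
  sSup {p | vgen q M N Λ ∉ p}

/-- the simple quotient `S'(Λ)`. -/
def SimpMod (q : ℂ) (M N : ℕ) (Λ : HW q M N) : Type :=
  VermaMod q M N true Λ ⧸ radV q M N Λ

instance (q : ℂ) (M N : ℕ) (Λ : HW q M N) : AddCommGroup (SimpMod q M N Λ) :=
  inferInstanceAs (AddCommGroup (VermaMod q M N true Λ ⧸ radV q M N Λ))
instance (q : ℂ) (M N : ℕ) (Λ : HW q M N) :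
    Module (ALG q M N true 3) (SimpMod q M N Λ) :=
  inferInstanceAs (Module (ALG q M N true 3) (VermaMod q M N true Λ ⧸ radV q M N Λ))
instance (q : ℂ) (M N : ℕ) (Λ : HW q M N) : Module ℂ (SimpMod q M N Λ) :=
  inferInstanceAs (Module ℂ (VermaMod q M N true Λ ⧸ radV q M N Λ))
instance (q : ℂ) (M N : ℕ) (Λ : HW q M N) :
    IsScalarTower ℂ (ALG q M N true 3) (SimpMod q M N Λ) :=
  inferInstanceAs (IsScalarTower ℂ (ALG q M N true 3) (VermaMod q M N true Λ ⧸ radV q M N Λ))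

/-! ### Weight spaces -/

/-- `K_i` for `0 ≤ i`, with `K₀` at `i = 0`. -/
def Kgen (q : ℂ) (M N : ℕ) (ext : Bool) (lvl : ℕ) (i : ℕ) : ALG q M N ext lvl :=
  if i = 0 then K0A q M N ext lvl else KA q M N ext lvl i

/-- the `μ`-weight space of a module. -/
def wtSp (q : ℂ) (M N : ℕ) (ext : Bool) {W : Type} [AddCommGroup W] [Module ℂ W]
    [Module (ALG q M N ext 3) W] [IsScalarTower ℂ (ALG q M N ext 3) W] (μ : ℕ → ℂ) :
    Submodule ℂ W where
  carrier := {w | ∀ i < M + N, Kgen q M N ext 3 i • w = μ i • w}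
  add_mem' := by
    intro a b ha hb i hi
    rw [smul_add, ha i hi, hb i hi, smul_add]
  zero_mem' := by
    intro i hi
    rw [smul_zero, smul_zero]
  smul_mem' := by
    intro c w hw i hi
    have h1 : Kgen q M N ext 3 i • (c • w) = c • (Kgen q M N ext 3 i • w) := by
      rw [← algebraMap_smul (ALG q M N ext 3) c w, ← mul_smul, ← Algebra.commutes, mul_smul,
        algebraMap_smul]
    rw [h1, hw i hi, smul_comm]

/-- the character `λ_Λ`. -/
def lamF (q : ℂ) (M N : ℕ) (Λ : HW q M N) : ℕ → ℂ :=
  fun i => if i = 0 then 1 else if i = M then Λ.c else qpar q M i ^ (Λ.P i).natDegree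

/-- the character `α_j`. -/
def alF (q : ℂ) (M : ℕ) (j : ℕ) : ℕ → ℂ :=
  fun i => if i = 0 then (if j = 1 then q else 1) else q ^ cc M j i

/-! ### The generators of `U` inside `U'` -/

def UGenSet (q : ℂ) (M N : ℕ) : Set (ALG q M N true 3) :=
  {x | (∃ i : ℕ, ∃ n : ℤ, x = XpA q M N true 3 i n) ∨
    (∃ i : ℕ, ∃ n : ℤ, x = XmA q M N true 3 i n) ∨
    (∃ i : ℕ, x = KA q M N true 3 i) ∨ (∃ i : ℕ, x = KiA q M N true 3 i) ∨
    ∃ i : ℕ, ∃ s : ℤ, x = HA q M N true 3 i s}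

/-! ### One-sided presentations (for `U^±`) -/

def XgF (M N : ℕ) (i : ℕ) (n : ℤ) : FreeAlgebra ℂ (Idx M N × ℤ) :=
  if h : 1 ≤ i ∧ i ≤ M + N - 1 then FreeAlgebra.ι ℂ ((⟨i, h⟩, n) : Idx M N × ℤ) else 0

inductive rel1 (q : ℂ) (M N : ℕ) (pl : Bool) :
    FreeAlgebra ℂ (Idx M N × ℤ) → FreeAlgebra ℂ (Idx M N × ℤ) → Prop
  | comm0 (i j : Idx M N) (m n : ℤ) (h : cc M i.1 j.1 = 0) :
      rel1 q M N pl
        (FreeAlgebra.ι ℂ ((i, m) : Idx M N × ℤ) * FreeAlgebra.ι ℂ ((j, n) : Idx M N × ℤ) -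
          sgn M i.1 j.1 •
            (FreeAlgebra.ι ℂ ((j, n) : Idx M N × ℤ) * FreeAlgebra.ι ℂ ((i, m) : Idx M N × ℤ))) 0
  | deg2 (i j : Idx M N) (m n : ℤ) (h : cc M i.1 j.1 ≠ 0) :
      rel1 q M N pl
        (FreeAlgebra.ι ℂ ((i, m + 1) : Idx M N × ℤ) * FreeAlgebra.ι ℂ ((j, n) : Idx M N × ℤ) -
          (q ^ (if pl then cc M i.1 j.1 else -cc M i.1 j.1)) •
            (FreeAlgebra.ι ℂ ((j, n) : Idx M N × ℤ) *
              FreeAlgebra.ι ℂ ((i, m + 1) : Idx M N × ℤ)))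
        ((q ^ (if pl then cc M i.1 j.1 else -cc M i.1 j.1)) •
            (FreeAlgebra.ι ℂ ((i, m) : Idx M N × ℤ) *
              FreeAlgebra.ι ℂ ((j, n + 1) : Idx M N × ℤ)) -
          FreeAlgebra.ι ℂ ((j, n + 1) : Idx M N × ℤ) * FreeAlgebra.ι ℂ ((i, m) : Idx M N × ℤ))
  | serre (i j : Idx M N) (m n k : ℤ) (h : cc M i.1 j.1 = 1 ∨ cc M i.1 j.1 = -1)
      (hi : i.1 ≠ M) :
      rel1 q M N pl
        (brF q (FreeAlgebra.ι ℂ ((i, m) : Idx M N × ℤ))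
            (brF q⁻¹ (FreeAlgebra.ι ℂ ((i, n) : Idx M N × ℤ))
              (FreeAlgebra.ι ℂ ((j, k) : Idx M N × ℤ))) +
          brF q (FreeAlgebra.ι ℂ ((i, n) : Idx M N × ℤ))
            (brF q⁻¹ (FreeAlgebra.ι ℂ ((i, m) : Idx M N × ℤ))
              (FreeAlgebra.ι ℂ ((j, k) : Idx M N × ℤ)))) 0
  | osc (m n k u : ℤ) (hM : 1 < M) (hN : 1 < N) :
      rel1 q M N pl (oscOf q M (XgF M N) m n k u + oscOf q M (XgF M N) m u k n) 0

end QAS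

namespace QAS

/-- the subspace `Ṽ⁻Ṽ⁰Ṽ⁺I⁺Ṽ⁺` of `Ṽ`. -/
def Tplus6 (q : ℂ) (M N : ℕ) : Submodule ℂ (ALG q M N false 1) :=
  Subalgebra.toSubmodule (Aminus q M N false 1) * Subalgebra.toSubmodule (Azero q M N false 1) *
    Subalgebra.toSubmodule (Aplus q M N false 1) * IsubAll q M N false 1 true *
    Subalgebra.toSubmodule (Aplus q M N false 1)

/-- the subspace `Ṽ⁻I⁻Ṽ⁻Ṽ⁰Ṽ⁺` of `Ṽ`. -/
def Tminus6 (q : ℂ) (M N : ℕ) : Submodule ℂ (ALG q M N false 1) :=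
  Subalgebra.toSubmodule (Aminus q M N false 1) * IsubAll q M N false 1 false *
    Subalgebra.toSubmodule (Aminus q M N false 1) * Subalgebra.toSubmodule (Azero q M N false 1) *
    Subalgebra.toSubmodule (Aplus q M N false 1)

end QAS

namespace QAS

section Abstract
open PowerSeries

/-- Euler operator on power series. -/
def eul {A : Type} [Ring A] (F : PowerSeries A) : PowerSeries A :=
  PowerSeries.mk fun m => (m : A) * PowerSeries.coeff m F

theorem eul_mul {A : Type} [Ring A] (F G : PowerSeries A) :
    eul (F * G) = eul F * G + F * eul G := by
  ext m
  simp only [eul, coeff_mk, coeff_mul, map_add, Finset.mul_sum, ← Finset.sum_add_distrib]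
  refine Finset.sum_congr rfl fun p hp => ?_
  rw [Finset.HasAntidiagonal.mem_antidiagonal] at hp
  have h : (p.2 : A) * coeff p.1 F = coeff p.1 F * (p.2 : A) := Nat.cast_commute _ _
  rw [← hp, Nat.cast_add, add_mul, ← mul_assoc, ← mul_assoc, ← mul_assoc, h]

/-- uniqueness of solutions of `z F' = B F` -/
theorem eul_unique {A : Type} [Ring A] [Algebra ℂ A] (B F G : PowerSeries A)
    (hB : coeff 0 B = 0) (h0 : coeff 0 F = coeff 0 G)
    (hF : eul F = B * F) (hG : eul G = B * G) : F = G := by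
  ext m
  induction m using Nat.strong_induction_on with
  | _ m ih =>
    rcases Nat.eq_zero_or_pos m with rfl | hm
    · exact h0
    have e1 := congrArg (coeff m) hF
    have e2 := congrArg (coeff m) hG
    simp only [eul, coeff_mk, coeff_mul] at e1 e2
    have : (m : A) * coeff m F = (m : A) * coeff m G := by
      rw [e1, e2]
      refine Finset.sum_congr rfl fun p hp => ?_
      rw [Finset.HasAntidiagonal.mem_antidiagonal] at hp
      rcases Nat.eq_zero_or_pos p.1 with h | h
      · rw [h, hB, zero_mul, zero_mul]
      · rw [ih p.2 (by omega)]
    have hm' : (m : ℂ) ≠ 0 := by exact_mod_cast hm.ne'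
    have e : ∀ x : A, (m : A) * x = (m : ℂ) • x := fun x => by
      rw [Algebra.smul_def, map_natCast]
    rw [e, e] at this
    exact smul_right_injective A hm' this

def gco (v : ℂ) : ℕ → ℂ
  | 0 => 1
  | j + 1 => v ^ j * (v - v⁻¹)

theorem gco_sum (v : ℂ) (hv : v ≠ 0) (k : ℕ) :
    ∑ s ∈ Finset.range (k + 1), (v ^ s - (v ^ s)⁻¹) * gco v (k - s) = k * gco v k := by
  induction k with
  | zero => simp
  | succ k ih =>
    rcases k with _ | k
    · simp [Finset.sum_range_succ, gco]
    rw [Finset.sum_range_succ, Finset.sum_range_succ]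
    rw [Finset.sum_range_succ] at ih
    have : ∑ s ∈ Finset.range (k + 1), (v ^ s - (v ^ s)⁻¹) * gco v (k + 1 + 1 - s)
        = v * ∑ s ∈ Finset.range (k + 1), (v ^ s - (v ^ s)⁻¹) * gco v (k + 1 - s) := by
      rw [Finset.mul_sum]
      refine Finset.sum_congr rfl fun s hs => ?_
      rw [Finset.mem_range] at hs
      obtain ⟨r, hr⟩ : ∃ r, k = s + r := ⟨k - s, by omega⟩
      subst hr
      rw [show s + r + 1 + 1 - s = r + 1 + 1 by omega, show s + r + 1 - s = r + 1 by omega]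
      simp only [gco]; ring
    rw [this, eq_sub_of_add_eq ih]
    simp only [Nat.sub_self, Nat.add_sub_cancel_left, gco]
    push_cast
    field_simp
    ring

theorem expC_eul {A : Type} [Ring A] [Algebra ℂ A] (t : ℂ) (a : ℕ → A) :
    eul (PowerSeries.mk (expC t a)) =
      PowerSeries.mk (fun s => (t * s) • a s) * PowerSeries.mk (expC t a) := by
  ext m
  rcases m with _ | m
  · simp [eul]
  simp only [eul, coeff_mk, coeff_mul]
  rw [Finset.Nat.sum_antidiagonal_eq_sum_range_succ
    (f := fun i j => ((t * (i : ℂ)) • a i) * expC t a j), Finset.sum_range_succ', expC]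
  have hm' : ((m : ℂ) + 1) ≠ 0 := by exact_mod_cast (Nat.succ_ne_zero m)
  have e : ∀ x : A, ((m + 1 : ℕ) : A) * x = ((m : ℂ) + 1) • x := fun x => by
    rw [Algebra.smul_def]; simp
  rw [e, smul_inv_smul₀ hm', Finset.smul_sum]
  simp only [Nat.cast_zero, mul_zero, zero_smul, zero_mul, add_zero]
  refine Finset.sum_congr rfl fun s _ => ?_
  rw [smul_smul, smul_mul_assoc, Nat.add_sub_add_right]
  push_cast; rfl

/-- the closed form of `E(z) X_n` -/
theorem expC_closed {A : Type} [Ring A] [Algebra ℂ A] (t v : ℂ) (hv : v ≠ 0) (a : ℕ → A)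
    (X : ℤ → A)
    (ha : ∀ (s : ℕ) (n : ℤ), (t * s) • (a s * X n - X n * a s) =
      (v ^ s - (v ^ s)⁻¹) • X (n + s)) (n : ℤ) :
    PowerSeries.mk (expC t a) * PowerSeries.C (X n) =
      PowerSeries.mk (fun j => gco v j • X (n + j)) * PowerSeries.mk (expC t a) := by
  set E := PowerSeries.mk (expC t a)
  set B := PowerSeries.mk (fun s : ℕ => (t * s) • a s)
  set Y := PowerSeries.mk (fun j : ℕ => gco v j • X (n + j)) with hY
  have hE : eul E = B * E := expC_eul t a
  have hYB : eul Y = B * Y - Y * B := by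
    ext k
    rw [map_sub, coeff_mul, coeff_mul, ← Finset.Nat.sum_antidiagonal_swap
        (f := fun p => coeff p.1 Y * coeff p.2 B)]
    simp only [Prod.fst_swap, Prod.snd_swap]
    rw [← Finset.sum_sub_distrib]
    simp only [eul, coeff_mk, B, Y]
    have : ∀ p ∈ Finset.HasAntidiagonal.antidiagonal k,
        ((t * (p.1 : ℂ)) • a p.1) * (gco v p.2 • X (n + p.2)) -
          (gco v p.2 • X (n + p.2)) * ((t * (p.1 : ℂ)) • a p.1) =
        ((v ^ p.1 - (v ^ p.1)⁻¹) * gco v p.2) • X (n + k) := by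
      intro p hp
      rw [Finset.HasAntidiagonal.mem_antidiagonal] at hp
      have h := ha p.1 (n + p.2)
      rw [show n + (p.2 : ℤ) + (p.1 : ℤ) = n + k by rw [← hp]; push_cast; ring] at h
      rw [mul_comm (_ - _), mul_smul (gco v p.2), ← h, smul_mul_smul_comm, smul_mul_smul_comm, smul_sub,
        smul_sub, smul_smul, smul_smul, mul_comm (gco v p.2)]
    rw [Finset.sum_congr rfl this, ← Finset.sum_smul,
      Finset.Nat.sum_antidiagonal_eq_sum_range_succ
        (f := fun i j => (v ^ i - (v ^ i)⁻¹) * gco v j), gco_sum v hv, mul_smul,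
        Algebra.smul_def (k : ℂ), map_natCast]
  have hC : eul (PowerSeries.C (X n)) = 0 := by
    ext m
    rcases m with _ | m <;> simp [eul, PowerSeries.coeff_C]
  refine eul_unique B _ _ (by simp [B]) ?_ ?_ ?_
  · simp [E, Y, gco, expC]
  · rw [eul_mul, hE, hC]; noncomm_ring
  · rw [eul_mul, hE, hYB]; noncomm_ring

theorem expC_rel {A : Type} [Ring A] [Algebra ℂ A] (t v : ℂ) (hv : v ≠ 0) (a : ℕ → A)
    (X : ℤ → A)
    (ha : ∀ (s : ℕ) (n : ℤ), (t * s) • (a s * X n - X n * a s) =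
      (v ^ s - (v ^ s)⁻¹) • X (n + s)) (m : ℕ) (n : ℤ) :
    expC t a (m + 1) * X n - v • (expC t a m * X (n + 1)) - X n * expC t a (m + 1)
      + v⁻¹ • (X (n + 1) * expC t a m) = 0 := by
  have h : ∀ (k : ℕ) (n : ℤ), expC t a k * X n =
      ∑ j ∈ Finset.range (k + 1), gco v j • (X (n + j) * expC t a (k - j)) := by
    intro k n
    have := congrArg (coeff k) (expC_closed t v hv a X ha n)
    rw [PowerSeries.coeff_mul_C, coeff_mul] at this
    simp only [coeff_mk] at this
    rw [this, Finset.Nat.sum_antidiagonal_eq_sum_range_succ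
      (f := fun i j => (gco v i • X (n + i)) * expC t a j)]
    simp only [smul_mul_assoc]
  rw [h, h, Finset.sum_range_succ', Finset.sum_range_succ' _ m, Finset.sum_range_succ' _ m]
  simp only [smul_add, Finset.smul_sum, gco]
  have : ∀ j ∈ Finset.range m, (v ^ (j + 1) * (v - v⁻¹)) •
      (X (n + ((j + 1 + 1 : ℕ) : ℤ)) * expC t a (m + 1 - (j + 1 + 1))) =
      v • (v ^ j * (v - v⁻¹)) • (X (n + 1 + ((j + 1 : ℕ) : ℤ)) * expC t a (m - (j + 1))) := by
    intro j _
    rw [smul_smul, Nat.add_sub_add_right]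
    congr 1
    · ring
    · congr 2; push_cast; ring
  rw [Finset.sum_congr rfl this]
  simp only [Nat.cast_zero, add_zero, Nat.cast_one, zero_add, Nat.sub_zero, pow_zero, one_mul,
    one_smul, Nat.add_sub_cancel, sub_smul]
  abel

/-- abstract current relation -/
theorem phi_rel {A : Type} [Ring A] [Algebra ℂ A] (t v : ℂ) (hv : v ≠ 0) (K : A) (a : ℕ → A)
    (X φ : ℤ → A) (hK : ∀ n, K * X n = v • (X n * K))
    (ha : ∀ (s : ℕ) (n : ℤ), (t * s) • (a s * X n - X n * a s) =
      (v ^ s - (v ^ s)⁻¹) • X (n + s))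
    (hφ : ∀ n, φ n = if 0 ≤ n then K * expC t a n.toNat else 0) (m n : ℤ) :
    φ (m + 1) * X n - v • (X n * φ (m + 1)) - v • (φ m * X (n + 1)) + X (n + 1) * φ m = 0 := by
  have hK' : ∀ n, X n * K = v⁻¹ • (K * X n) := fun n => by rw [hK, inv_smul_smul₀ hv]
  rcases lt_trichotomy m (-1) with h | h | h
  · rw [hφ, hφ, if_neg (by omega), if_neg (by omega)]; simp
  · subst h
    rw [hφ, hφ, if_pos (by omega), if_neg (by omega)]
    simp [expC, hK]
  · lift m to ℕ using (by omega)
    rw [hφ, hφ, if_pos (by omega), if_pos (by omega)]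
    have := expC_rel t v hv a X ha m n
    rw [Int.toNat_natCast, show ((m : ℤ) + 1).toNat = m + 1 by omega]
    rw [← mul_assoc (X n), ← mul_assoc (X (n+1)), hK' n, hK' (n+1), smul_mul_assoc,
      smul_mul_assoc, smul_inv_smul₀ hv]
    rw [← mul_zero K, ← this]
    simp only [mul_add, mul_sub, mul_assoc, mul_smul_comm]
    abel

theorem phi_comm {A : Type} [Ring A] [Algebra ℂ A] 
    (X φ : ℤ → A) (h0 : ∀ m < 0, φ m = 0)
    (h : ∀ m n, φ (m + 1) * X n - (1:ℂ) • (X n * φ (m + 1)) - (1:ℂ) • (φ m * X (n + 1))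
      + X (n + 1) * φ m = 0) (m n : ℤ) : φ m * X n = X n * φ m := by
  rcases lt_or_ge m 0 with hm | hm
  · simp [h0 m hm]
  lift m to ℕ using hm
  have key : ∀ (m : ℕ) n, φ ((m : ℤ) - 1) * X n = X n * φ ((m : ℤ) - 1) := by
    intro m
    induction m with
    | zero => intro n; simp [h0]
    | succ m ih =>
      intro n
      have := h (m - 1) n
      have h2 := ih (n + 1)
      rw [one_smul, one_smul, sub_add_cancel, h2, sub_add_cancel] at this
      push_cast
      rw [add_sub_cancel_right]
      exact sub_eq_zero.mp this
  have := key (m + 1) n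
  push_cast at this
  rwa [add_sub_cancel_right] at this

/-- the reflected version, for `φ⁻` -/
theorem phi_rel_neg {A : Type} [Ring A] [Algebra ℂ A] (t v : ℂ) (hv : v ≠ 0) (K : A) (a : ℕ → A)
    (X φ : ℤ → A) (hK : ∀ n, K * X n = v⁻¹ • (X n * K))
    (ha : ∀ (s : ℕ) (n : ℤ), (t * s) • (a s * X n - X n * a s) =
      ((v ^ s)⁻¹ - v ^ s) • X (n - s))
    (hφ : ∀ n, φ n = if n ≤ 0 then K * expC t a (-n).toNat else 0) (m n : ℤ) :
    φ (m + 1) * X n - v • (X n * φ (m + 1)) - v • (φ m * X (n + 1)) + X (n + 1) * φ m = 0 := by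
  have := phi_rel t v⁻¹ (inv_ne_zero hv) K a (fun n => X (-n)) (fun n => φ (-n))
    (fun n => hK _) (fun s n => by
      rw [ha, inv_pow, inv_inv]; congr 2; ring)
    (fun n => by simp only [hφ]; simp) (-m - 1) (-n - 1)
  have h2 := congrArg (fun x => (-v) • x) this
  simp only [smul_add, smul_sub, smul_zero, neg_smul, smul_inv_smul₀ hv] at h2
  rw [← h2]
  simp only [show -(-m - 1 + 1) = m by ring, show -(-m-1) = m + 1 by ring,
    show -(-n - 1 + 1) = n by ring, show -(-n-1) = n + 1 by ring]
  abel

/-- bracket computation, `c ≠ 0` -/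
theorem brk_ne {A : Type} [Ring A] [Algebra ℂ A] (v s s' : ℂ) (x x' Ψ Ψ' : ℤ → A) (y : A)
    (h : ∀ m, x m * y = s • (y * x m) + Ψ m) (h' : ∀ m, x' m * y = s' • (y * x' m) + Ψ' m)
    (hs : ∀ m, s' • Ψ m = Ψ m) (hs' : ∀ m, s • Ψ' m = Ψ' m)
    (r : ∀ m n, Ψ (m + 1) * x' n - v • (x' n * Ψ (m + 1)) - v • (Ψ m * x' (n + 1))
      + x' (n + 1) * Ψ m = 0)
    (r' : ∀ m n, Ψ' (m + 1) * x n - v • (x n * Ψ' (m + 1)) - v • (Ψ' m * x (n + 1))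
      + x (n + 1) * Ψ' m = 0) (m n : ℤ) :
    (x (m + 1) * x' n - v • (x' n * x (m + 1)) - v • (x m * x' (n + 1)) + x' (n + 1) * x m) * y
    - (s * s') • (y * (x (m + 1) * x' n - v • (x' n * x (m + 1)) - v • (x m * x' (n + 1))
      + x' (n + 1) * x m)) = 0 := by
  have e1 : ∀ m n, x m * x' n * y = (s * s') • (y * (x m * x' n)) + Ψ m * x' n + x m * Ψ' n := by
    intro m n
    rw [mul_assoc, h', mul_add, mul_smul_comm, ← mul_assoc, h, add_mul, smul_add,
      ← smul_mul_assoc s' (Ψ m), hs, smul_mul_assoc, smul_smul, mul_comm s' s, mul_assoc]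
  have e2 : ∀ m n, x' n * x m * y = (s * s') • (y * (x' n * x m)) + Ψ' n * x m + x' n * Ψ m := by
    intro m n
    rw [mul_assoc, h, mul_add, mul_smul_comm, ← mul_assoc, h', add_mul, smul_add,
      ← smul_mul_assoc s (Ψ' n), hs', smul_mul_assoc, smul_smul, mul_assoc]
  have r1 := r m n
  have r2 := r' n m
  simp only [add_mul, sub_mul, smul_mul_assoc, e1, e2, mul_add, mul_sub, mul_smul_comm, smul_add,
    smul_sub, smul_comm _ v]
  rw [← add_zero (0 : A)]
  nth_rewrite 1 [← r1]
  rw [← r2]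
  abel

theorem brk_eq {A : Type} [Ring A] [Algebra ℂ A] (σ s s' : ℂ) (x x' Ψ Ψ' : ℤ → A) (y : A)
    (h : ∀ m, x m * y = s • (y * x m) + Ψ m) (h' : ∀ m, x' m * y = s' • (y * x' m) + Ψ' m)
    (hs : ∀ m, s' • Ψ m = σ • Ψ m) (hs' : ∀ m, (σ * s) • Ψ' m = Ψ' m)
    (r : ∀ m n, Ψ m * x' n = x' n * Ψ m)
    (r' : ∀ m n, Ψ' m * x n = x n * Ψ' m) (m n : ℤ) :
    (x m * x' n - σ • (x' n * x m)) * y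
    - (s * s') • (y * (x m * x' n - σ • (x' n * x m))) = 0 := by
  have e1 : ∀ m n, x m * x' n * y =
      (s * s') • (y * (x m * x' n)) + σ • (x' n * Ψ m) + x m * Ψ' n := by
    intro m n
    rw [mul_assoc, h', mul_add, mul_smul_comm, ← mul_assoc, h, add_mul, smul_add,
      ← smul_mul_assoc s' (Ψ m), hs, smul_mul_assoc, smul_smul, mul_comm s' s, mul_assoc,
      smul_mul_assoc, r]
  have e2 : ∀ m n, σ • (x' n * x m * y) =
      (s * s') • (y * (σ • (x' n * x m))) + x m * Ψ' n + σ • (x' n * Ψ m) := by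
    intro m n
    rw [mul_assoc, h, mul_add, mul_smul_comm, ← mul_assoc, h', add_mul, smul_add,
      smul_add, smul_add, smul_smul, smul_smul, ← smul_mul_assoc (σ * s) (Ψ' n),
      hs', smul_mul_assoc, smul_smul, mul_assoc, r', mul_smul_comm, smul_smul]
    rw [mul_assoc y, show σ * (s * s') = s * s' * σ by ring]
  rw [sub_mul, smul_mul_assoc, e1, e2, mul_sub, smul_sub]
  abel

end Abstract
end QAS

namespace QAS

section Star
variable {S : Type} [IdemSemiring S]

/-- `P` behaves like the subalgebra generated by `P1`. -/
structure IsStar (P1 P : S) : Prop where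
  one : 1 ≤ P
  mul : P * P ≤ P
  gen : P1 ≤ P
  left : ∀ N W : S, N ≤ W → P1 * W ≤ W → P * N ≤ W
  right : ∀ N W : S, N ≤ W → W * P1 ≤ W → N * P ≤ W

theorem IsStar.swapR {Z1 Z X : S} (h : IsStar Z1 Z) (hx : X * Z1 ≤ Z * X) : X * Z ≤ Z * X := by
  refine h.right _ _ ?_ ?_
  · calc X = 1 * X := (one_mul _).symm
      _ ≤ Z * X := mul_le_mul' h.one le_rfl
  · calc Z * X * Z1 = Z * (X * Z1) := mul_assoc _ _ _
      _ ≤ Z * (Z * X) := mul_le_mul' le_rfl hx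
      _ = Z * Z * X := (mul_assoc _ _ _).symm
      _ ≤ Z * X := mul_le_mul' h.mul le_rfl

theorem IsStar.swapL {P1 P X : S} (h : IsStar P1 P) (hx : P1 * X ≤ X * P) : P * X ≤ X * P := by
  refine h.left _ _ ?_ ?_
  · calc X = X * 1 := (mul_one _).symm
      _ ≤ X * P := mul_le_mul' le_rfl h.one
  · calc P1 * (X * P) = (P1 * X) * P := (mul_assoc _ _ _).symm
      _ ≤ (X * P) * P := mul_le_mul' hx le_rfl
      _ = X * (P * P) := mul_assoc _ _ _
      _ ≤ X * P := mul_le_mul' le_rfl h.mul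

theorem star_PZ {P1 P Z1 Z : S} (hP : IsStar P1 P) (hZ : IsStar Z1 Z)
    (a1 : P1 * Z1 ≤ Z * P1) : P * Z ≤ Z * P :=
  hP.swapL ((hZ.swapR a1).trans (mul_le_mul' le_rfl hP.gen))

theorem star_ZM {Z1 Z M1 M : S} (hZ : IsStar Z1 Z) (hM : IsStar M1 M)
    (a2 : Z1 * M1 ≤ M1 * Z) : Z * M ≤ M * Z :=
  hM.swapR ((hZ.swapL a2).trans (mul_le_mul' hM.gen le_rfl))

theorem star_PM1 {P1 P Z1 Z M1 : S} (hP : IsStar P1 P) (hZ : IsStar Z1 Z)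
    (a1 : P1 * Z1 ≤ Z * P1) (a3 : P1 * M1 ≤ M1 * P1 + Z) : P * M1 ≤ M1 * P + Z * P := by
  have h1 : P1 * Z ≤ Z * P1 := hZ.swapR a1
  have hPP : P1 * P ≤ P := (mul_le_mul' hP.gen le_rfl).trans hP.mul
  refine hP.left _ _ ?_ ?_
  · calc M1 = M1 * 1 := (mul_one _).symm
      _ ≤ M1 * P := mul_le_mul' le_rfl hP.one
      _ ≤ _ := by simp [add_eq_sup]
  · calc P1 * (M1 * P + Z * P) = (P1 * M1) * P + (P1 * Z) * P := by
          simp only [mul_add, mul_assoc]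
      _ ≤ (M1 * P1 + Z) * P + (Z * P1) * P := add_le_add (mul_le_mul' a3 le_rfl)
          (mul_le_mul' h1 le_rfl)
      _ = M1 * (P1 * P) + Z * P + Z * (P1 * P) := by simp only [add_mul, mul_assoc]
      _ ≤ M1 * P + Z * P + Z * P := by gcongr
      _ = _ := by rw [add_assoc, add_idem]

theorem star_P1M {P1 Z1 Z M1 M : S} (hZ : IsStar Z1 Z) (hM : IsStar M1 M)
    (a2 : Z1 * M1 ≤ M1 * Z) (a3 : P1 * M1 ≤ M1 * P1 + Z) : P1 * M ≤ M * P1 + M * Z := by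
  have h1 : Z * M1 ≤ M1 * Z := hZ.swapL a2
  have hMM : M * M1 ≤ M := (mul_le_mul' le_rfl hM.gen).trans hM.mul
  refine hM.right _ _ ?_ ?_
  · calc P1 = 1 * P1 := (one_mul _).symm
      _ ≤ M * P1 := mul_le_mul' hM.one le_rfl
      _ ≤ _ := by simp [add_eq_sup]
  · calc (M * P1 + M * Z) * M1 = M * (P1 * M1) + M * (Z * M1) := by
          simp only [add_mul, mul_assoc]
      _ ≤ M * (M1 * P1 + Z) + M * (M1 * Z) := add_le_add (mul_le_mul' le_rfl a3)
          (mul_le_mul' le_rfl h1)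
      _ = (M * M1) * P1 + M * Z + (M * M1) * Z := by simp only [mul_add, mul_assoc]
      _ ≤ M * P1 + M * Z + M * Z := by gcongr
      _ = _ := by rw [add_assoc, add_idem]

theorem star_Tplus {P1 P Z1 Z M1 M I : S} (hP : IsStar P1 P) (hZ : IsStar Z1 Z)
    (hM : IsStar M1 M)
    (a1 : P1 * Z1 ≤ Z * P1) (a2 : Z1 * M1 ≤ M1 * Z) (a3 : P1 * M1 ≤ M1 * P1 + Z)
    (a4 : I * Z1 ≤ Z * I) (a5 : I * M1 ≤ M1 * I) {g : S} (hg : g = P1 ∨ g = Z1 ∨ g = M1) :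
    M * Z * P * I * P * g ≤ M * Z * P * I * P ∧ g * (M * Z * P * I * P) ≤ M * Z * P * I * P := by
  have hPZ := star_PZ hP hZ a1
  have hZM := star_ZM hZ hM a2
  have hPM := star_PM1 hP hZ a1 a3
  have hP1M := star_P1M hZ hM a2 a3
  have hIZ : I * Z ≤ Z * I := hZ.swapR a4
  have hP1Z : P1 * Z ≤ Z * P1 := hZ.swapR a1
  have hZM1 : Z * M1 ≤ M1 * Z := hZ.swapL a2
  have mP := hP.mul
  have mZ := hZ.mul
  have mM := hM.mul
  have gP := hP.gen
  have gZ := hZ.gen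
  have gM := hM.gen
  -- absorbing a `Z` on the right of the leading `P I P`
  have zz : M * Z * P * Z ≤ M * Z * P := by
    calc M * Z * P * Z = M * Z * (P * Z) := by simp only [mul_assoc]
      _ ≤ M * Z * (Z * P) := by gcongr
      _ = M * (Z * Z) * P := by simp only [mul_assoc]
      _ ≤ M * Z * P := by gcongr
  have mm : M * Z * P * M1 ≤ M * Z * P := by
    calc M * Z * P * M1 = M * Z * (P * M1) := by simp only [mul_assoc]
      _ ≤ M * Z * (M1 * P + Z * P) := by gcongr
      _ = M * (Z * M1) * P + M * (Z * Z) * P := by simp only [mul_assoc, mul_add]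
      _ ≤ M * (M1 * Z) * P + M * Z * P := by gcongr
      _ = (M * M1) * Z * P + M * Z * P := by simp only [mul_assoc]
      _ ≤ (M * M) * Z * P + M * Z * P := by gcongr
      _ ≤ M * Z * P + M * Z * P := by gcongr
      _ = M * Z * P := add_idem _
  rcases hg with rfl | rfl | rfl
  · constructor
    · calc M * Z * P * I * P * g = M * Z * P * I * (P * g) := by simp only [mul_assoc]
        _ ≤ M * Z * P * I * (P * P) := by gcongr
        _ ≤ _ := by gcongr
    · calc g * (M * Z * P * I * P) = (g * M) * (Z * P * I * P) := by simp only [mul_assoc]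
        _ ≤ (M * g + M * Z) * (Z * P * I * P) := by gcongr
        _ = M * (g * Z) * P * I * P + M * (Z * Z) * P * I * P := by
            simp only [mul_assoc, add_mul]
        _ ≤ M * (Z * g) * P * I * P + M * Z * P * I * P := by gcongr
        _ ≤ M * (Z * P) * P * I * P + M * Z * P * I * P := by gcongr
        _ = M * Z * (P * P) * I * P + M * Z * P * I * P := by simp only [mul_assoc]
        _ ≤ M * Z * P * I * P + M * Z * P * I * P := by gcongr
        _ = _ := add_idem _
  · constructor
    · calc M * Z * P * I * P * g ≤ M * Z * P * I * P * Z := by gcongr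
        _ = M * Z * P * I * (P * Z) := by simp only [mul_assoc]
        _ ≤ M * Z * P * I * (Z * P) := by gcongr
        _ = M * Z * P * (I * Z) * P := by simp only [mul_assoc]
        _ ≤ M * Z * P * (Z * I) * P := by gcongr
        _ = (M * Z * P * Z) * I * P := by simp only [mul_assoc]
        _ ≤ _ := by gcongr
    · calc g * (M * Z * P * I * P) ≤ Z * (M * Z * P * I * P) := by gcongr
        _ = (Z * M) * (Z * P * I * P) := by simp only [mul_assoc]
        _ ≤ (M * Z) * (Z * P * I * P) := by gcongr
        _ = M * (Z * Z) * P * I * P := by simp only [mul_assoc]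
        _ ≤ _ := by gcongr
  · constructor
    · calc M * Z * P * I * P * g = M * Z * P * I * (P * g) := by simp only [mul_assoc]
        _ ≤ M * Z * P * I * (g * P + Z * P) := by gcongr
        _ = M * Z * P * (I * g) * P + M * Z * P * (I * Z) * P := by
            simp only [mul_assoc, mul_add]
        _ ≤ M * Z * P * (g * I) * P + M * Z * P * (Z * I) * P := by gcongr
        _ = (M * Z * P * g) * I * P + (M * Z * P * Z) * I * P := by simp only [mul_assoc]
        _ ≤ M * Z * P * I * P + M * Z * P * I * P := by gcongr
        _ = _ := add_idem _
    · calc g * (M * Z * P * I * P) = (g * M) * (Z * P * I * P) := by simp only [mul_assoc]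
        _ ≤ (M * M) * (Z * P * I * P) := by gcongr
        _ ≤ M * (Z * P * I * P) := by gcongr
        _ = _ := by simp only [mul_assoc]

theorem star_Tminus {P1 P Z1 Z M1 M I : S} (hP : IsStar P1 P) (hZ : IsStar Z1 Z)
    (hM : IsStar M1 M)
    (a1 : P1 * Z1 ≤ Z * P1) (a2 : Z1 * M1 ≤ M1 * Z) (a3 : P1 * M1 ≤ M1 * P1 + Z)
    (a4 : Z1 * I ≤ I * Z) (a5 : P1 * I ≤ I * P1) {g : S} (hg : g = P1 ∨ g = Z1 ∨ g = M1) :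
    M * I * M * Z * P * g ≤ M * I * M * Z * P ∧ g * (M * I * M * Z * P) ≤ M * I * M * Z * P := by
  have hPZ := star_PZ hP hZ a1
  have hZM := star_ZM hZ hM a2
  have hPM := star_PM1 hP hZ a1 a3
  have hP1M := star_P1M hZ hM a2 a3
  have hIZ : Z * I ≤ I * Z := hZ.swapL a4
  have hP1Z : P1 * Z ≤ Z * P1 := hZ.swapR a1
  have hZM1 : Z * M1 ≤ M1 * Z := hZ.swapL a2
  have mP := hP.mul
  have mZ := hZ.mul
  have mM := hM.mul
  have gP := hP.gen
  have gZ := hZ.gen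
  have gM := hM.gen
  have zz : Z * (M * (Z * P)) ≤ M * (Z * P) := by
    calc Z * (M * (Z * P)) = (Z * M) * (Z * P) := by simp only [mul_assoc]
      _ ≤ (M * Z) * (Z * P) := by gcongr
      _ = M * ((Z * Z) * P) := by simp only [mul_assoc]
      _ ≤ M * (Z * P) := by gcongr
  have pp : P1 * (M * (Z * P)) ≤ M * (Z * P) := by
    calc P1 * (M * (Z * P)) = (P1 * M) * (Z * P) := by simp only [mul_assoc]
      _ ≤ (M * P1 + M * Z) * (Z * P) := by gcongr
      _ = M * ((P1 * Z) * P) + M * ((Z * Z) * P) := by simp only [mul_assoc, add_mul]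
      _ ≤ M * ((Z * P1) * P) + M * (Z * P) := by gcongr
      _ ≤ M * ((Z * P) * P) + M * (Z * P) := by gcongr
      _ = M * (Z * (P * P)) + M * (Z * P) := by simp only [mul_assoc]
      _ ≤ M * (Z * P) + M * (Z * P) := by gcongr
      _ = M * (Z * P) := add_idem _
  have e : M * I * M * Z * P = M * (I * (M * (Z * P))) := by simp only [mul_assoc]
  rw [e]
  rcases hg with rfl | rfl | rfl
  · constructor
    · calc M * (I * (M * (Z * P))) * g = M * (I * (M * (Z * (P * g)))) := by
            simp only [mul_assoc]
        _ ≤ M * (I * (M * (Z * (P * P)))) := by gcongr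
        _ ≤ _ := by gcongr
    · calc g * (M * (I * (M * (Z * P)))) = (g * M) * (I * (M * (Z * P))) := by
            simp only [mul_assoc]
        _ ≤ (M * g + M * Z) * (I * (M * (Z * P))) := by gcongr
        _ = M * ((g * I) * (M * (Z * P))) + M * ((Z * I) * (M * (Z * P))) := by
            simp only [mul_assoc, add_mul]
        _ ≤ M * ((I * g) * (M * (Z * P))) + M * ((I * Z) * (M * (Z * P))) := by gcongr
        _ = M * (I * (g * (M * (Z * P)))) + M * (I * (Z * (M * (Z * P)))) := by
            simp only [mul_assoc]
        _ ≤ M * (I * (M * (Z * P))) + M * (I * (M * (Z * P))) := by gcongr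
        _ = _ := add_idem _
  · constructor
    · calc M * (I * (M * (Z * P))) * g ≤ M * (I * (M * (Z * P))) * Z := by gcongr
        _ = M * (I * (M * (Z * (P * Z)))) := by simp only [mul_assoc]
        _ ≤ M * (I * (M * (Z * (Z * P)))) := by gcongr
        _ = M * (I * (M * ((Z * Z) * P))) := by simp only [mul_assoc]
        _ ≤ _ := by gcongr
    · calc g * (M * (I * (M * (Z * P)))) ≤ Z * (M * (I * (M * (Z * P)))) := by gcongr
        _ = (Z * M) * (I * (M * (Z * P))) := by simp only [mul_assoc]
        _ ≤ (M * Z) * (I * (M * (Z * P))) := by gcongr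
        _ = M * ((Z * I) * (M * (Z * P))) := by simp only [mul_assoc]
        _ ≤ M * ((I * Z) * (M * (Z * P))) := by gcongr
        _ = M * (I * (Z * (M * (Z * P)))) := by simp only [mul_assoc]
        _ ≤ _ := by gcongr
  · constructor
    · calc M * (I * (M * (Z * P))) * g = M * (I * (M * (Z * (P * g)))) := by
            simp only [mul_assoc]
        _ ≤ M * (I * (M * (Z * (g * P + Z * P)))) := by gcongr
        _ = M * (I * (M * ((Z * g) * P))) + M * (I * (M * ((Z * Z) * P))) := by
            simp only [mul_assoc, mul_add]
        _ ≤ M * (I * (M * ((g * Z) * P))) + M * (I * (M * (Z * P))) := by gcongr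
        _ ≤ M * (I * (M * ((M * Z) * P))) + M * (I * (M * (Z * P))) := by gcongr
        _ = M * (I * ((M * M) * (Z * P))) + M * (I * (M * (Z * P))) := by
            simp only [mul_assoc]
        _ ≤ M * (I * (M * (Z * P))) + M * (I * (M * (Z * P))) := by gcongr
        _ = _ := add_idem _
    · calc g * (M * (I * (M * (Z * P)))) = (g * M) * (I * (M * (Z * P))) := by
            simp only [mul_assoc]
        _ ≤ (M * M) * (I * (M * (Z * P))) := by gcongr
        _ ≤ _ := by gcongr

theorem isStar_adjoin {A : Type} [Ring A] [Algebra ℂ A] (s : Set A) :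
    IsStar (Submodule.span ℂ s) (Subalgebra.toSubmodule (Algebra.adjoin ℂ s)) where
  one := by
    rw [Submodule.one_le]
    exact (Algebra.adjoin ℂ s).one_mem
  mul := by
    rw [Submodule.mul_le]
    exact fun x hx y hy => (Algebra.adjoin ℂ s).mul_mem hx hy
  gen := Submodule.span_le.mpr Algebra.subset_adjoin
  left := by
    intro N W h1 h2
    have key : ∀ p ∈ Algebra.adjoin ℂ s, ∀ w ∈ W, p * w ∈ W := by
      intro p hp
      induction hp using Algebra.adjoin_induction with
      | mem x hx => exact fun w hw => h2 (Submodule.mul_mem_mul (Submodule.subset_span hx) hw)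
      | algebraMap r =>
        intro w hw
        rw [← Algebra.smul_def]
        exact W.smul_mem _ hw
      | add x y _ _ hx hy =>
        intro w hw
        rw [add_mul]
        exact W.add_mem (hx w hw) (hy w hw)
      | mul x y _ _ hx hy =>
        intro w hw
        rw [mul_assoc]
        exact hx _ (hy w hw)
    rw [Submodule.mul_le]
    exact fun x hx y hy => key x hx y (h1 hy)
  right := by
    intro N W h1 h2
    have key : ∀ p ∈ Algebra.adjoin ℂ s, ∀ w ∈ W, w * p ∈ W := by
      intro p hp
      induction hp using Algebra.adjoin_induction with
      | mem x hx => exact fun w hw => h2 (Submodule.mul_mem_mul hw (Submodule.subset_span hx))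
      | algebraMap r =>
        intro w hw
        rw [← Algebra.commutes, ← Algebra.smul_def]
        exact W.smul_mem _ hw
      | add x y _ _ hx hy =>
        intro w hw
        rw [mul_add]
        exact W.add_mem (hx w hw) (hy w hw)
      | mul x y _ _ hx hy =>
        intro w hw
        rw [← mul_assoc]
        exact hy _ (hx w hw)
    rw [Submodule.mul_le]
    exact fun x hx y hy => key y hy x (h1 hx)

end Star
end QAS

namespace QAS

section Concrete
variable (q : ℂ) (M N : ℕ)

/-- the generators of sign `pl`. -/
def XA (pl : Bool) : ℕ → ℤ → ALG q M N false 1 :=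
  if pl then XpA q M N false 1 else XmA q M N false 1

/-- the signed exponent. -/
def eA (pl : Bool) (c : ℤ) : ℤ := if pl then c else -c

/-- admissible indices. -/
def InR (i : ℕ) : Prop := 1 ≤ i ∧ i ≤ M + N - 1

variable {q M N}

theorem mk_rel {a b : FA M N false} (h : rel q M N false 1 a b) :
    mkA q M N false 1 a = mkA q M N false 1 b := RingQuot.mkAlgHom_rel ℂ h

theorem XA_true_in {i : ℕ} (hi : InR M N i) (n : ℤ) :
    XA q M N true i n = mkA q M N false 1 (gi (Gen.Xp ⟨i, hi⟩ n)) := by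
  have hi' : 1 ≤ i ∧ i ≤ M + N - 1 := hi
  simp [XA, XpA, XpF, hi']

theorem XA_false_in {i : ℕ} (hi : InR M N i) (n : ℤ) :
    XA q M N false i n = mkA q M N false 1 (gi (Gen.Xm ⟨i, hi⟩ n)) := by
  have hi' : 1 ≤ i ∧ i ≤ M + N - 1 := hi
  simp [XA, XmA, XmF, hi']

theorem XA_out (pl : Bool) {i : ℕ} (hi : ¬ InR M N i) (n : ℤ) : XA q M N pl i n = 0 := by
  have hi' : ¬ (1 ≤ i ∧ i ≤ M + N - 1) := hi
  cases pl
  · simp only [XA, XmA, XmF, dif_neg hi', map_zero, Bool.false_eq_true, if_false]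
  · simp only [XA, XpA, XpF, dif_neg hi', map_zero, if_true]

theorem KA_in {i : ℕ} (hi : InR M N i) :
    KA q M N false 1 i = mkA q M N false 1 (gi (Gen.K ⟨i, hi⟩)) := by
  have hi' : 1 ≤ i ∧ i ≤ M + N - 1 := hi
  simp [KA, KF, hi']

theorem KiA_in {i : ℕ} (hi : InR M N i) :
    KiA q M N false 1 i = mkA q M N false 1 (gi (Gen.Ki ⟨i, hi⟩)) := by
  have hi' : 1 ≤ i ∧ i ≤ M + N - 1 := hi
  simp [KiA, KiF, hi']

theorem HA_in {i : ℕ} (hi : InR M N i) {s : ℤ} (hs : s ≠ 0) :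
    HA q M N false 1 i s = mkA q M N false 1 (gi (Gen.H ⟨i, hi⟩ ⟨s, hs⟩)) := by
  have hi' : (1 ≤ i ∧ i ≤ M + N - 1) ∧ s ≠ 0 := ⟨hi, hs⟩
  simp only [HA, HF, dif_pos hi']

theorem KA_out {i : ℕ} (hi : ¬ InR M N i) : KA q M N false 1 i = 0 := by
  have hi' : ¬ (1 ≤ i ∧ i ≤ M + N - 1) := hi
  simp only [KA, KF, dif_neg hi', map_zero]

theorem KiA_out {i : ℕ} (hi : ¬ InR M N i) : KiA q M N false 1 i = 0 := by
  have hi' : ¬ (1 ≤ i ∧ i ≤ M + N - 1) := hi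
  simp only [KiA, KiF, dif_neg hi', map_zero]

theorem HA_out {i : ℕ} {s : ℤ} (hi : ¬ (InR M N i ∧ s ≠ 0)) : HA q M N false 1 i s = 0 := by
  have hi' : ¬ ((1 ≤ i ∧ i ≤ M + N - 1) ∧ s ≠ 0) := hi
  simp only [HA, HF, dif_neg hi', map_zero]

theorem KA_X (pl : Bool) (j i : ℕ) (n : ℤ) :
    KA q M N false 1 j * XA q M N pl i n =
      q ^ eA pl (cc M j i) • (XA q M N pl i n * KA q M N false 1 j) := by
  by_cases hj : InR M N j
  · by_cases hi : InR M N i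
    · cases pl
      · have := mk_rel (q := q) (rel.KXm ⟨j, hj⟩ ⟨i, hi⟩ n)
        rw [map_smul, map_mul, map_mul] at this
        rw [KA_in hj, XA_false_in hi, this]
        rfl
      · have := mk_rel (q := q) (rel.KXp ⟨j, hj⟩ ⟨i, hi⟩ n)
        rw [map_smul, map_mul, map_mul] at this
        rw [KA_in hj, XA_true_in hi, this]
        rfl
    · simp [XA_out pl hi]
  · simp [KA_out hj]

theorem KiA_KA {j : ℕ} (hj : InR M N j) : KiA q M N false 1 j * KA q M N false 1 j = 1 := by
  have := mk_rel (q := q) (rel.KiK ⟨j, hj⟩)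
  rw [map_mul, map_one] at this
  rw [KA_in hj, KiA_in hj, this]

theorem KA_KiA {j : ℕ} (hj : InR M N j) : KA q M N false 1 j * KiA q M N false 1 j = 1 := by
  have := mk_rel (q := q) (rel.KKi ⟨j, hj⟩)
  rw [map_mul, map_one] at this
  rw [KA_in hj, KiA_in hj, this]

theorem KiA_X (hq0 : q ≠ 0) (pl : Bool) (j i : ℕ) (n : ℤ) :
    KiA q M N false 1 j * XA q M N pl i n =
      (q ^ eA pl (cc M j i))⁻¹ • (XA q M N pl i n * KiA q M N false 1 j) := by
  by_cases hj : InR M N j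
  · have hv : q ^ eA pl (cc M j i) ≠ 0 := zpow_ne_zero _ hq0
    have h := KA_X (q := q) (M := M) (N := N) pl j i n
    calc KiA q M N false 1 j * XA q M N pl i n
        = KiA q M N false 1 j * XA q M N pl i n *
          (KA q M N false 1 j * KiA q M N false 1 j) := by rw [KA_KiA hj, mul_one]
      _ = KiA q M N false 1 j * (XA q M N pl i n * KA q M N false 1 j) *
            KiA q M N false 1 j := by simp only [mul_assoc]
      _ = KiA q M N false 1 j * ((q ^ eA pl (cc M j i))⁻¹ •
            (KA q M N false 1 j * XA q M N pl i n)) * KiA q M N false 1 j := by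
          rw [h, smul_smul, inv_mul_cancel₀ hv, one_smul]
      _ = (q ^ eA pl (cc M j i))⁻¹ • ((KiA q M N false 1 j * KA q M N false 1 j) *
            XA q M N pl i n * KiA q M N false 1 j) := by
          simp only [mul_smul_comm, smul_mul_assoc, mul_assoc]
      _ = _ := by rw [KiA_KA hj, one_mul]
  · simp [KiA_out hj]

theorem smul_neg_aux {A : Type} [Ring A] [Algebra ℂ A] (c : ℂ) (x : A) :
    (-c) • x = -(c • x) := neg_smul c x

theorem HA_X (pl : Bool) {j : ℕ} (hj : InR M N j) (i : ℕ) {s : ℤ} (hs : s ≠ 0) (n : ℤ) :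
    HA q M N false 1 j s * XA q M N pl i n - XA q M N pl i n * HA q M N false 1 j s =
      ((if pl then (1 : ℂ) else -1) * (qint (qpar q M j) (s * lof M j * cc M j i) / (s : ℂ))) •
        XA q M N pl i (n + s) := by
  by_cases hi : InR M N i
  · cases pl
    · have := mk_rel (q := q) (rel.HXm ⟨j, hj⟩ ⟨i, hi⟩ ⟨s, hs⟩ n)
      rw [map_neg, map_smul, map_sub, map_mul, map_mul] at this
      rw [HA_in hj hs, XA_false_in hi, XA_false_in hi, this]
      simp only [Bool.false_eq_true, if_false, neg_one_mul]
      exact (smul_neg_aux _ _).symm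
    · have := mk_rel (q := q) (rel.HXp ⟨j, hj⟩ ⟨i, hi⟩ ⟨s, hs⟩ n)
      rw [map_smul, map_sub, map_mul, map_mul] at this
      rw [HA_in hj hs, XA_true_in hi, XA_true_in hi, this]
      simp
  · simp [XA_out pl hi]

theorem lof_sq (j : ℕ) : lof M j * lof M j = 1 := by
  unfold lof; split_ifs <;> norm_num

theorem qpar_ne (hq0 : q ≠ 0) (hq1 : ∀ k : ℕ, k ≠ 0 → q ^ k ≠ 1) (j : ℕ) :
    qpar q M j - (qpar q M j)⁻¹ ≠ 0 := by
  have h2 : q ^ 2 ≠ 1 := hq1 2 (by norm_num)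
  intro h
  apply h2
  unfold qpar lof at h
  split_ifs at h
  · rw [zpow_one] at h
    field_simp at h
    linear_combination h
  · rw [zpow_neg, zpow_one, inv_inv] at h
    field_simp at h
    linear_combination -h

theorem H_scalar (hq0 : q ≠ 0) (hq1 : ∀ k : ℕ, k ≠ 0 → q ^ k ≠ 1) (pl : Bool) (j : ℕ) (c s : ℤ)
    (hs : s ≠ 0) :
    (qpar q M j - (qpar q M j)⁻¹) * (s : ℂ) *
      ((if pl then (1 : ℂ) else -1) * (qint (qpar q M j) (s * lof M j * c) / (s : ℂ))) =
    (q ^ eA pl c) ^ s - (q ^ eA pl c) ^ (-s) := by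
  have ht := qpar_ne (M := M) hq0 hq1 j
  have hs' : (s : ℂ) ≠ 0 := by exact_mod_cast hs
  have e1 : (qpar q M j - (qpar q M j)⁻¹) * (s : ℂ) *
      (qint (qpar q M j) (s * lof M j * c) / (s : ℂ)) = q ^ (s * c) - q ^ (-(s * c)) := by
    have : ∀ m : ℤ, qpar q M j ^ (m * lof M j) = q ^ m := by
      intro m
      unfold qpar
      rw [← zpow_mul, mul_comm m, ← mul_assoc, lof_sq, one_mul]
    have e2 : qint (qpar q M j) (s * lof M j * c) =
        (q ^ (s * c) - q ^ (-(s * c))) / (qpar q M j - (qpar q M j)⁻¹) := by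
      unfold qint
      rw [show s * lof M j * c = (s * c) * lof M j by ring,
        show -(s * c * lof M j) = (-(s * c)) * lof M j by ring, this, this]
    rw [e2]
    generalize qpar q M j - (qpar q M j)⁻¹ = t at ht ⊢
    field_simp
  have e3 : ∀ x y : ℤ, (q ^ x) ^ y = q ^ (x * y) := fun x y => (zpow_mul q x y).symm
  rw [e3, e3]
  cases pl
  · simp only [eA, Bool.false_eq_true, if_false]
    rw [neg_one_mul, mul_neg, e1, neg_sub]
    congr 2 <;> ring
  · simp only [eA, if_true]
    rw [one_mul, e1]
    congr 2 <;> ring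

theorem HA_X' (hq0 : q ≠ 0) (hq1 : ∀ k : ℕ, k ≠ 0 → q ^ k ≠ 1) (pl : Bool) {j : ℕ}
    (hj : InR M N j) (i : ℕ) (s n : ℤ) :
    ((qpar q M j - (qpar q M j)⁻¹) * (s : ℂ)) •
      (HA q M N false 1 j s * XA q M N pl i n - XA q M N pl i n * HA q M N false 1 j s) =
      ((q ^ eA pl (cc M j i)) ^ s - (q ^ eA pl (cc M j i)) ^ (-s)) • XA q M N pl i (n + s) := by
  by_cases hs : s = 0
  · subst hs
    simp
  · rw [HA_X pl hj i hs n, smul_smul, H_scalar hq0 hq1 pl j _ s hs]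

theorem map_expC {A B : Type} [Ring A] [Algebra ℂ A] [Ring B] [Algebra ℂ B] (f : A →ₐ[ℂ] B)
    (t : ℂ) (a : ℕ → A) (n : ℕ) : f (expC t a n) = expC t (fun s => f (a s)) n := by
  induction n using Nat.strong_induction_on with
  | _ n ih =>
    cases n with
    | zero => rw [expC, expC, map_one]
    | succ n =>
      rw [expC, expC, map_smul, map_smul, map_sum]
      congr 2
      refine Finset.sum_congr rfl fun s hs => ?_
      rw [map_smul, map_mul, ih _ (by omega)]

theorem phiPA_eq (i : ℕ) (n : ℤ) : phiPA q M N false 1 i n =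
    if 0 ≤ n then KA q M N false 1 i * expC (qpar q M i - (qpar q M i)⁻¹)
      (fun s => HA q M N false 1 i (s : ℤ)) n.toNat else 0 := by
  unfold phiPA phiPF
  split_ifs
  · rw [map_mul, map_expC]; rfl
  · rw [map_zero]

theorem phiMA_eq (i : ℕ) (n : ℤ) : phiMA q M N false 1 i n =
    if n ≤ 0 then KiA q M N false 1 i * expC (-(qpar q M i - (qpar q M i)⁻¹))
      (fun s => HA q M N false 1 i (-(s : ℤ))) (-n).toNat else 0 := by
  unfold phiMA phiMF
  split_ifs
  · rw [map_mul, map_expC]; rfl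
  · rw [map_zero]

/-- the current attached to `k`. -/
def phiA (q : ℂ) (M N : ℕ) (k : ℕ) (m : ℤ) : ALG q M N false 1 :=
  phiPA q M N false 1 k m - phiMA q M N false 1 k m

theorem curP (hq0 : q ≠ 0) (hq1 : ∀ k : ℕ, k ≠ 0 → q ^ k ≠ 1) (pl : Bool) {k : ℕ}
    (hk : InR M N k) (u : ℕ) (v : ℂ) (hv : v = q ^ eA pl (cc M k u)) (m n : ℤ) :
    phiPA q M N false 1 k (m + 1) * XA q M N pl u n
      - v • (XA q M N pl u n * phiPA q M N false 1 k (m + 1))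
      - v • (phiPA q M N false 1 k m * XA q M N pl u (n + 1))
      + XA q M N pl u (n + 1) * phiPA q M N false 1 k m = 0 := by
  refine phi_rel (qpar q M k - (qpar q M k)⁻¹) v (hv ▸ zpow_ne_zero _ hq0)
    (KA q M N false 1 k) (fun s => HA q M N false 1 k (s : ℤ)) _ _ ?_ ?_ (phiPA_eq k) m n
  · intro n
    rw [hv]
    exact KA_X pl k u n
  · intro s n
    have := HA_X' hq0 hq1 pl hk u (s : ℤ) n
    rw [← hv] at this
    simpa using this

theorem curM (hq0 : q ≠ 0) (hq1 : ∀ k : ℕ, k ≠ 0 → q ^ k ≠ 1) (pl : Bool) {k : ℕ}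
    (hk : InR M N k) (u : ℕ) (v : ℂ) (hv : v = q ^ eA pl (cc M k u)) (m n : ℤ) :
    phiMA q M N false 1 k (m + 1) * XA q M N pl u n
      - v • (XA q M N pl u n * phiMA q M N false 1 k (m + 1))
      - v • (phiMA q M N false 1 k m * XA q M N pl u (n + 1))
      + XA q M N pl u (n + 1) * phiMA q M N false 1 k m = 0 := by
  refine phi_rel_neg (-(qpar q M k - (qpar q M k)⁻¹)) v (hv ▸ zpow_ne_zero _ hq0)
    (KiA q M N false 1 k) (fun s => HA q M N false 1 k (-(s : ℤ))) _ _ ?_ ?_ (phiMA_eq k) m n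
  · intro n
    rw [hv]
    exact KiA_X hq0 pl k u n
  · intro s n
    have := HA_X' hq0 hq1 pl hk u (-(s : ℤ)) n
    rw [← hv] at this
    rw [neg_mul, ← mul_neg]
    simpa [sub_eq_add_neg] using this

theorem cur (hq0 : q ≠ 0) (hq1 : ∀ k : ℕ, k ≠ 0 → q ^ k ≠ 1) (pl : Bool) {k : ℕ}
    (hk : InR M N k) (u : ℕ) (v : ℂ) (hv : v = q ^ eA pl (cc M k u)) (m n : ℤ) :
    phiA q M N k (m + 1) * XA q M N pl u n
      - v • (XA q M N pl u n * phiA q M N k (m + 1))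
      - v • (phiA q M N k m * XA q M N pl u (n + 1))
      + XA q M N pl u (n + 1) * phiA q M N k m = 0 := by
  have h1 := curP hq0 hq1 pl hk u v hv m n
  have h2 := curM hq0 hq1 pl hk u v hv m n
  have h3 := congrArg₂ (· - ·) h1 h2
  simp only [sub_zero] at h3
  rw [← h3]
  simp only [phiA, sub_mul, mul_sub, smul_sub]
  abel

theorem cur_comm (hq0 : q ≠ 0) (hq1 : ∀ k : ℕ, k ≠ 0 → q ^ k ≠ 1) (pl : Bool) {k : ℕ}
    (hk : InR M N k) (u : ℕ) (hv : cc M k u = 0) (m n : ℤ) :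
    phiA q M N k m * XA q M N pl u n = XA q M N pl u n * phiA q M N k m := by
  have hv' : (1 : ℂ) = q ^ eA pl (cc M k u) := by
    rw [hv]; cases pl <;> simp [eA]
  have h1 : phiPA q M N false 1 k m * XA q M N pl u n =
      XA q M N pl u n * phiPA q M N false 1 k m := by
    refine phi_comm (XA q M N pl u) (phiPA q M N false 1 k) ?_ ?_ m n
    · intro m hm
      rw [phiPA_eq, if_neg (by omega)]
    · exact curP hq0 hq1 pl hk u 1 hv'
  have h2 : phiMA q M N false 1 k m * XA q M N pl u n =
      XA q M N pl u n * phiMA q M N false 1 k m := by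
    have := phi_comm (fun n => XA q M N pl u (-n)) (fun n => phiMA q M N false 1 k (-n)) ?_ ?_
      (-m) (-n)
    · simpa using this
    · intro m hm
      rw [phiMA_eq, if_neg (by omega)]
    · intro m n
      have := curM hq0 hq1 pl hk u 1 hv' (-(m + 1)) (-(n + 1))
      rw [show -(m + 1) + 1 = -m by ring, show -(n + 1) + 1 = -n by ring] at this
      simp only [one_smul] at this ⊢
      rw [← neg_eq_zero, ← this]
      abel
  rw [phiA, sub_mul, mul_sub, h1, h2]

end Concrete
end QAS

namespace QAS

section Brackets
variable {q : ℂ} {M N : ℕ}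

theorem sgn_comm (i j : ℕ) : sgn M i j = sgn M j i := by
  unfold sgn; simp only [and_comm]

theorem sgn_sq (i j : ℕ) : sgn M i j * sgn M i j = 1 := by
  unfold sgn; split_ifs <;> norm_num

theorem gsgn_eq (k u i : ℕ) : gsgn M k u i = sgn M k i * sgn M u i := by
  unfold gsgn sgn
  by_cases h1 : k = M <;> by_cases h2 : u = M <;> by_cases h3 : i = M <;> simp [h1, h2, h3]

theorem cc_comm (i j : ℕ) : cc M i j = cc M j i := by
  have h : ∀ a b, innerE M a b = innerE M b a := by
    intro a b
    unfold innerE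
    by_cases hab : a = b
    · subst hab; rfl
    · rw [if_neg hab, if_neg (Ne.symm hab)]
  unfold cc form4
  rw [h i j, h i (j + 1), h (i + 1) j, h (i + 1) (j + 1)]
  ring

theorem cc_MM : cc M M M = 0 := by
  simp [cc, form4, innerE, lof]

theorem bracket_flip {A : Type} [Ring A] [Algebra ℂ A] (σ : ℂ) (hσ : σ * σ = 1) (x y w : A)
    (h : x * y - σ • (y * x) = w) : y * x = σ • (x * y) + (-σ) • w := by
  rw [← h, smul_sub, smul_smul, neg_mul, hσ]
  simp

theorem XX_rel (pl : Bool) {k i : ℕ} (hk : InR M N k) (hi : InR M N i) (p : ℤ) :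
    ∃ τ : ℂ, ∀ m, XA q M N pl k m * XA q M N (!pl) i p =
      sgn M k i • (XA q M N (!pl) i p * XA q M N pl k m) +
        (if k = i then τ • phiA q M N k (m + p) else 0) := by
  have main : ∀ {k i : ℕ} (hk : InR M N k) (hi : InR M N i) (m p : ℤ),
      XA q M N true k m * XA q M N false i p -
        sgn M k i • (XA q M N false i p * XA q M N true k m) =
      if k = i then (qpar q M k - (qpar q M k)⁻¹)⁻¹ • phiA q M N k (m + p) else 0 := by
    intro k i hk hi m p
    have := mk_rel (q := q) (rel.XpXm ⟨k, hk⟩ ⟨i, hi⟩ m p)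
    rw [map_sub, map_smul, map_mul, map_mul] at this
    rw [XA_true_in hk, XA_false_in hi, this]
    by_cases h : k = i
    · subst h
      rw [if_pos rfl, if_pos rfl, map_smul, map_sub]
      rfl
    · rw [if_neg h, if_neg (fun h' => h (congrArg Subtype.val h')), map_zero]
  cases pl
  · refine ⟨-sgn M k k * (qpar q M k - (qpar q M k)⁻¹)⁻¹, fun m => ?_⟩
    have h := bracket_flip (sgn M i k) (sgn_sq _ _) _ _ _ (main hi hk p m)
    rw [Bool.not_false, h, sgn_comm i k]
    congr 1
    by_cases h : k = i
    · subst h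
      rw [if_pos rfl, if_pos rfl, smul_smul, add_comm p m]
    · rw [if_neg h, if_neg (Ne.symm h), smul_zero]
  · refine ⟨(qpar q M k - (qpar q M k)⁻¹)⁻¹, fun m => ?_⟩
    rw [Bool.not_true, ← main hk hi m p, add_sub_cancel]

theorem IElt_eq (pl : Bool) (i j : ℕ) (m n : ℤ) : IElt q M N false 1 pl i j m n =
    if cc M i j = 0 then
      XA q M N pl i m * XA q M N pl j n - sgn M i j • (XA q M N pl j n * XA q M N pl i m)
    else
      XA q M N pl i (m + 1) * XA q M N pl j n
        - (q ^ eA pl (cc M i j)) • (XA q M N pl j n * XA q M N pl i (m + 1))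
        - (q ^ eA pl (cc M i j)) • (XA q M N pl i m * XA q M N pl j (n + 1))
        + XA q M N pl j (n + 1) * XA q M N pl i m := rfl

theorem scale_cur {A : Type} [Ring A] [Algebra ℂ A] (τ v : ℂ) (a b x y : A)
    (h : a * x - v • (x * a) - v • (b * y) + y * b = 0) :
    (τ • a) * x - v • (x * (τ • a)) - v • ((τ • b) * y) + y * (τ • b) = 0 := by
  have h2 := congrArg (fun z => τ • z) h
  simp only [smul_add, smul_sub, smul_zero] at h2
  rw [← h2]
  simp only [smul_mul_assoc, mul_smul_comm, smul_comm τ v]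

theorem psi_cur (hq0 : q ≠ 0) (hq1 : ∀ k : ℕ, k ≠ 0 → q ^ k ≠ 1) (pl : Bool) {k : ℕ}
    (hk : InR M N k) (u : ℕ) (v : ℂ) (hv : v = q ^ eA pl (cc M k u)) (i : ℕ) (τ : ℂ)
    (p m n : ℤ) :
    (if k = i then τ • phiA q M N k (m + 1 + p) else 0) * XA q M N pl u n
      - v • (XA q M N pl u n * (if k = i then τ • phiA q M N k (m + 1 + p) else 0))
      - v • ((if k = i then τ • phiA q M N k (m + p) else 0) * XA q M N pl u (n + 1))
      + XA q M N pl u (n + 1) * (if k = i then τ • phiA q M N k (m + p) else 0) = 0 := by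
  by_cases h : k = i
  · simp only [if_pos h]
    rw [show m + 1 + p = (m + p) + 1 by ring]
    exact scale_cur _ _ _ _ _ _ (cur hq0 hq1 pl hk u v hv (m + p) n)
  · simp only [if_neg h]
    simp

theorem psi_comm (hq0 : q ≠ 0) (hq1 : ∀ k : ℕ, k ≠ 0 → q ^ k ≠ 1) (pl : Bool) {k : ℕ}
    (hk : InR M N k) (u : ℕ) (hv : cc M k u = 0) (i : ℕ) (τ : ℂ)
    (p m n : ℤ) :
    (if k = i then τ • phiA q M N k (m + p) else 0) * XA q M N pl u n =
      XA q M N pl u n * (if k = i then τ • phiA q M N k (m + p) else 0) := by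
  by_cases h : k = i
  · simp only [if_pos h]
    rw [smul_mul_assoc, mul_smul_comm, cur_comm hq0 hq1 pl hk u hv]
  · simp only [if_neg h]
    simp

theorem IElt_bracket (hq0 : q ≠ 0) (hq1 : ∀ k : ℕ, k ≠ 0 → q ^ k ≠ 1) (pl : Bool) {k u i : ℕ}
    (hk : InR M N k) (hu : InR M N u) (hi : InR M N i) (p m n : ℤ) :
    IElt q M N false 1 pl k u m n * XA q M N (!pl) i p
      - gsgn M k u i • (XA q M N (!pl) i p * IElt q M N false 1 pl k u m n) = 0 := by
  obtain ⟨τ, h⟩ := XX_rel (q := q) pl hk hi p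
  obtain ⟨τ', h'⟩ := XX_rel (q := q) pl hu hi p
  rw [gsgn_eq, IElt_eq]
  by_cases hc : cc M k u = 0
  · rw [if_pos hc]
    refine brk_eq (sgn M k u) (sgn M k i) (sgn M u i) _ _ _ _ _ h h' ?_ ?_ ?_ ?_ m n
    · intro m
      by_cases e : k = i
      · subst e
        rw [sgn_comm]
      · simp [if_neg e]
    · intro m
      by_cases e : u = i
      · subst e
        rw [sgn_sq, one_smul]
      · simp [if_neg e]
    · exact fun m n => psi_comm hq0 hq1 pl hk u hc i τ p m n
    · exact fun m n => psi_comm hq0 hq1 pl hu k (cc_comm (M := M) k u ▸ hc) i τ' p m n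
  · rw [if_neg hc]
    have hs : sgn M u k = 1 := by
      unfold sgn
      rw [if_neg]
      rintro ⟨rfl, rfl⟩
      exact hc cc_MM
    refine brk_ne _ (sgn M k i) (sgn M u i) _ _ _ _ _ h h' ?_ ?_ ?_ ?_ m n
    · intro m
      by_cases e : k = i
      · subst e
        rw [hs, one_smul]
      · simp [if_neg e]
    · intro m
      by_cases e : u = i
      · subst e
        rw [sgn_comm, hs, one_smul]
      · simp [if_neg e]
    · exact fun m n => psi_cur hq0 hq1 pl hk u _ rfl i τ p m n
    · exact fun m n => psi_cur hq0 hq1 pl hu k _ (by rw [cc_comm]) i τ' p m n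

theorem bracket_span {A : Type} [Ring A] [Algebra ℂ A] (s : Set A) (g : ℂ) (y : A)
    (h : ∀ x ∈ s, x * y - g • (y * x) = 0) (x : A) (hx : x ∈ Submodule.span ℂ s) :
    x * y - g • (y * x) = 0 := by
  induction hx using Submodule.span_induction with
  | mem x hx => exact h x hx
  | zero => simp
  | add a b _ _ ha hb =>
    have := congrArg₂ (· + ·) ha hb
    simp only [add_zero] at this
    rw [← this, add_mul, mul_add, smul_add]
    abel
  | smul c a _ ha =>
    rw [smul_mul_assoc, mul_smul_comm, smul_comm g c, ← smul_sub, ha, smul_zero]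

theorem Isub_bracket (hq0 : q ≠ 0) (hq1 : ∀ k : ℕ, k ≠ 0 → q ^ k ≠ 1) (pl : Bool) {k u i : ℕ}
    (hk : InR M N k) (hu : InR M N u) (hi : InR M N i) (p : ℤ) (x : ALG q M N false 1)
    (hx : x ∈ Isub q M N false 1 pl k u) :
    x * XA q M N (!pl) i p - gsgn M k u i • (XA q M N (!pl) i p * x) = 0 := by
  refine bracket_span _ _ _ ?_ x hx
  rintro _ ⟨⟨m, n⟩, rfl⟩
  exact IElt_bracket hq0 hq1 pl hk hu hi p m n

end Brackets

section Laws
variable {A : Type} [Ring A] [Algebra ℂ A]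

/-- commutation law of `z` with a doubly indexed family. -/
def Law (z : A) (c d d' : ℂ) (s : ℤ) (F : ℤ → ℤ → A) : Prop :=
  ∀ m n, z * F m n = c • (F m n * z) + d • F (m + s) n + d' • F m (n + s)

variable {z : A} {c d d' : ℂ} {s : ℤ} {F G : ℤ → ℤ → A}

theorem Law.add (hF : Law z c d d' s F) (hG : Law z c d d' s G) :
    Law z c d d' s (fun m n => F m n + G m n) := by
  intro m n
  simp only
  rw [mul_add, hF, hG, add_mul]
  simp only [smul_add]
  abel

theorem Law.smul (a : ℂ) (hF : Law z c d d' s F) : Law z c d d' s (fun m n => a • F m n) := by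
  intro m n
  simp only
  rw [mul_smul_comm, hF, smul_mul_assoc]
  simp only [smul_add, smul_comm a]

theorem Law.sub (hF : Law z c d d' s F) (hG : Law z c d d' s G) :
    Law z c d d' s (fun m n => F m n - G m n) := by
  intro m n
  simp only
  rw [mul_sub, hF, hG, sub_mul]
  simp only [smul_sub]
  abel

theorem Law.shift (a b : ℤ) (hF : Law z c d d' s F) :
    Law z c d d' s (fun m n => F (m + a) (n + b)) := by
  intro m n
  simp only
  rw [hF, add_right_comm m a s, add_right_comm n b s]

theorem law_xx {κ κ' : ℂ} {x x' : ℤ → A}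
    (h : ∀ n, z * x n = κ • (x n * z) + d • x (n + s))
    (h' : ∀ n, z * x' n = κ' • (x' n * z) + d' • x' (n + s))
    (e : κ * d' = d') :
    Law z (κ * κ') d d' s (fun m n => x m * x' n) := by
  intro m n
  simp only
  rw [← mul_assoc, h, add_mul, smul_mul_assoc, mul_assoc (x m), h', mul_add, smul_add,
    mul_smul_comm, mul_smul_comm, smul_smul, smul_smul, e, smul_mul_assoc, ← mul_assoc]
  abel

theorem law_xx' {κ κ' : ℂ} {x x' : ℤ → A}
    (h : ∀ n, z * x n = κ • (x n * z) + d • x (n + s))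
    (h' : ∀ n, z * x' n = κ' • (x' n * z) + d' • x' (n + s))
    (e : κ' * d = d) :
    Law z (κ * κ') d d' s (fun m n => x' n * x m) := by
  intro m n
  have := law_xx h' h e n m
  simp only at this ⊢
  rw [this, mul_comm κ' κ]
  abel

end Laws
end QAS

namespace QAS

section Ideals
variable {q : ℂ} {M N : ℕ}

/-- generators of the Cartan part. -/
def ZSet (q : ℂ) (M N : ℕ) : Set (ALG q M N false 1) :=
  {x | (∃ i : ℕ, x = KA q M N false 1 i) ∨ (∃ i : ℕ, x = KiA q M N false 1 i) ∨
    ∃ i : ℕ, ∃ s : ℤ, x = HA q M N false 1 i s}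

/-- generators of sign `pl`. -/
def XSet (q : ℂ) (M N : ℕ) (pl : Bool) : Set (ALG q M N false 1) :=
  {x | ∃ i : ℕ, ∃ n : ℤ, x = XA q M N pl i n}

/-- spanning set of `I`. -/
def ISet (q : ℂ) (M N : ℕ) (pl : Bool) : Set (ALG q M N false 1) :=
  {x | ∃ k u : ℕ, ∃ m n : ℤ, (1 ≤ k ∧ k ≤ u ∧ u ≤ M + N - 1) ∧
    x = IElt q M N false 1 pl k u m n}

theorem IsubAll_eq (pl : Bool) :
    IsubAll q M N false 1 pl = Submodule.span ℂ (ISet q M N pl) := by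
  apply le_antisymm
  · refine iSup₂_le fun p hp => Submodule.span_mono ?_
    rintro _ ⟨⟨m, n⟩, rfl⟩
    exact ⟨p.1, p.2, m, n, hp, rfl⟩
  · rw [Submodule.span_le]
    rintro _ ⟨k, u, m, n, h, rfl⟩
    exact Submodule.mem_iSup_of_mem (k, u)
      (Submodule.mem_iSup_of_mem h (Submodule.subset_span ⟨(m, n), rfl⟩))

theorem z_data (hq0 : q ≠ 0) (pl : Bool) (z : ALG q M N false 1) (hz : z ∈ ZSet q M N) :
    ∃ (κ d : ℕ → ℂ) (s : ℤ), (∀ i, κ i ≠ 0) ∧ (∀ i j, κ i * d j = d j) ∧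
      ∀ i n, z * XA q M N pl i n = κ i • (XA q M N pl i n * z) + d i • XA q M N pl i (n + s) := by
  rcases hz with ⟨j, rfl⟩ | ⟨j, rfl⟩ | ⟨j, s, rfl⟩
  · refine ⟨fun i => q ^ eA pl (cc M j i), fun _ => 0, 0, fun i => zpow_ne_zero _ hq0,
      fun _ _ => mul_zero _, fun i n => ?_⟩
    simp only
    rw [zero_smul, add_zero, KA_X]
  · refine ⟨fun i => (q ^ eA pl (cc M j i))⁻¹, fun _ => 0, 0,
      fun i => inv_ne_zero (zpow_ne_zero _ hq0), fun _ _ => mul_zero _, fun i n => ?_⟩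
    simp only
    rw [zero_smul, add_zero, KiA_X hq0]
  · by_cases h : InR M N j ∧ s ≠ 0
    · refine ⟨fun _ => 1, fun i => (if pl then (1 : ℂ) else -1) *
        (qint (qpar q M j) (s * lof M j * cc M j i) / (s : ℂ)), s, fun _ => one_ne_zero,
        fun _ _ => one_mul _, fun i n => ?_⟩
      have := HA_X (q := q) pl h.1 i h.2 n
      rw [one_smul]
      exact sub_eq_iff_eq_add'.mp this
    · refine ⟨fun _ => 1, fun _ => 0, 0, fun _ => one_ne_zero, fun _ _ => one_mul _,
        fun i n => ?_⟩
      rw [HA_out h]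
      simp

theorem swap_span {A : Type} [Ring A] [Algebra ℂ A] (S Zs : Set A)
    (h : ∀ z ∈ Zs, ∀ x ∈ S, ∃ c : ℂ, c ≠ 0 ∧ ∃ w ∈ Submodule.span ℂ S, z * x = c • (x * z) + w) :
    Submodule.span ℂ S * Submodule.span ℂ Zs ≤
      Subalgebra.toSubmodule (Algebra.adjoin ℂ Zs) * Submodule.span ℂ S ∧
    Submodule.span ℂ Zs * Submodule.span ℂ S ≤
      Submodule.span ℂ S * Subalgebra.toSubmodule (Algebra.adjoin ℂ Zs) := by
  constructor
  · rw [Submodule.span_mul_span, Submodule.span_le]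
    rintro _ ⟨x, hx, z, hz, rfl⟩
    obtain ⟨c, hc, w, hw, e⟩ := h z hz x hx
    have e2 : x * z = c⁻¹ • (z * x) - c⁻¹ • (1 * w) := by
      rw [e, smul_add, smul_smul, inv_mul_cancel₀ hc]
      simp
    simp only [SetLike.mem_coe]
    rw [e2]
    refine Submodule.sub_mem _ (Submodule.smul_mem _ _ (Submodule.mul_mem_mul ?_ ?_))
      (Submodule.smul_mem _ _ (Submodule.mul_mem_mul ?_ hw))
    · exact Algebra.subset_adjoin hz
    · exact Submodule.subset_span hx
    · exact (Algebra.adjoin ℂ Zs).one_mem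
  · rw [Submodule.span_mul_span, Submodule.span_le]
    rintro _ ⟨z, hz, x, hx, rfl⟩
    obtain ⟨c, hc, w, hw, e⟩ := h z hz x hx
    simp only [SetLike.mem_coe]
    rw [e, ← mul_one w]
    refine Submodule.add_mem _ (Submodule.smul_mem _ _ (Submodule.mul_mem_mul ?_ ?_))
      (Submodule.mul_mem_mul hw ?_)
    · exact Submodule.subset_span hx
    · exact Algebra.subset_adjoin hz
    · exact (Algebra.adjoin ℂ Zs).one_mem

theorem X_swap (hq0 : q ≠ 0) (pl : Bool) : ∀ z ∈ ZSet q M N, ∀ x ∈ XSet q M N pl,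
    ∃ c : ℂ, c ≠ 0 ∧ ∃ w ∈ Submodule.span ℂ (XSet q M N pl), z * x = c • (x * z) + w := by
  rintro z hz _ ⟨i, n, rfl⟩
  obtain ⟨κ, d, s, h1, _, h3⟩ := z_data hq0 pl z hz
  exact ⟨κ i, h1 i, _, Submodule.smul_mem _ _ (Submodule.subset_span ⟨i, n + s, rfl⟩), h3 i n⟩

theorem I_law (pl : Bool) (z : ALG q M N false 1) (κ d : ℕ → ℂ) (s : ℤ)
    (h2 : ∀ i j, κ i * d j = d j)
    (h3 : ∀ i n, z * XA q M N pl i n =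
      κ i • (XA q M N pl i n * z) + d i • XA q M N pl i (n + s)) (k u : ℕ) :
    Law z (κ k * κ u) (d k) (d u) s (IElt q M N false 1 pl k u) := by
  have hF := law_xx (h3 k) (h3 u) (h2 k u)
  have hG := law_xx' (h3 k) (h3 u) (h2 u k)
  by_cases hc : cc M k u = 0
  · have := hF.sub (hG.smul (sgn M k u))
    intro m n
    simp only [IElt_eq, if_pos hc]
    exact this m n
  · have := (((hF.shift 1 0).sub ((hG.shift 1 0).smul (q ^ eA pl (cc M k u)))).sub
      ((hF.shift 0 1).smul (q ^ eA pl (cc M k u)))).add (hG.shift 0 1)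
    intro m n
    simp only [IElt_eq, if_neg hc]
    have := this m n
    simp only [add_zero] at this
    exact this

theorem I_swap (hq0 : q ≠ 0) (pl : Bool) : ∀ z ∈ ZSet q M N, ∀ x ∈ ISet q M N pl,
    ∃ c : ℂ, c ≠ 0 ∧ ∃ w ∈ Submodule.span ℂ (ISet q M N pl), z * x = c • (x * z) + w := by
  rintro z hz _ ⟨k, u, m, n, h, rfl⟩
  obtain ⟨κ, d, s, h1, h2, h3⟩ := z_data hq0 pl z hz
  have := I_law pl z κ d s h2 h3 k u m n
  rw [add_assoc] at this
  exact ⟨κ k * κ u, mul_ne_zero (h1 k) (h1 u), _, Submodule.add_mem _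
    (Submodule.smul_mem _ _ (Submodule.subset_span ⟨k, u, m + s, n, h, rfl⟩))
    (Submodule.smul_mem _ _ (Submodule.subset_span ⟨k, u, m, n + s, h, rfl⟩)), this⟩

theorem expC_mem {A : Type} [Ring A] [Algebra ℂ A] (B : Subalgebra ℂ A) (t : ℂ) (a : ℕ → A)
    (ha : ∀ s, a s ∈ B) (n : ℕ) : expC t a n ∈ B := by
  induction n using Nat.strong_induction_on with
  | _ n ih =>
    cases n with
    | zero => rw [expC]; exact B.one_mem
    | succ n =>
      rw [expC]
      refine B.smul_mem (B.smul_mem (B.sum_mem fun s hs => B.smul_mem (B.mul_mem (ha _) ?_) _) _) _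
      exact ih _ (by omega)

theorem phiA_mem (k : ℕ) (m : ℤ) : phiA q M N k m ∈ Algebra.adjoin ℂ (ZSet q M N) := by
  have hH : ∀ s, HA q M N false 1 k s ∈ Algebra.adjoin ℂ (ZSet q M N) :=
    fun s => Algebra.subset_adjoin (Or.inr (Or.inr ⟨k, s, rfl⟩))
  refine Subalgebra.sub_mem _ ?_ ?_
  · rw [phiPA_eq]
    split_ifs
    · exact Subalgebra.mul_mem _ (Algebra.subset_adjoin (Or.inl ⟨k, rfl⟩))
        (expC_mem _ _ _ (fun s => hH _) _)
    · exact Subalgebra.zero_mem _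
  · rw [phiMA_eq]
    split_ifs
    · exact Subalgebra.mul_mem _ (Algebra.subset_adjoin (Or.inr (Or.inl ⟨k, rfl⟩)))
        (expC_mem _ _ _ (fun s => hH _) _)
    · exact Subalgebra.zero_mem _

theorem PM_le : Submodule.span ℂ (XSet q M N true) * Submodule.span ℂ (XSet q M N false) ≤
    Submodule.span ℂ (XSet q M N false) * Submodule.span ℂ (XSet q M N true) +
      Subalgebra.toSubmodule (Algebra.adjoin ℂ (ZSet q M N)) := by
  rw [Submodule.span_mul_span, Submodule.span_le]
  rintro _ ⟨_, ⟨k, m, rfl⟩, _, ⟨i, p, rfl⟩, rfl⟩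
  simp only [SetLike.mem_coe]
  by_cases hk : InR M N k
  · by_cases hi : InR M N i
    · obtain ⟨τ, h⟩ := XX_rel (q := q) true hk hi p
      have h := h m
      rw [Bool.not_true] at h
      rw [h]
      refine Submodule.add_mem_sup (Submodule.smul_mem _ _ (Submodule.mul_mem_mul
        (Submodule.subset_span ⟨i, p, rfl⟩) (Submodule.subset_span ⟨k, m, rfl⟩))) ?_
      split_ifs
      · exact Submodule.smul_mem _ _ (phiA_mem _ _)
      · exact Submodule.zero_mem _
    · rw [XA_out false hi, mul_zero]
      exact Submodule.zero_mem _
  · rw [XA_out true hk, zero_mul]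
    exact Submodule.zero_mem _

theorem gsgn_ne (k u i : ℕ) : gsgn M k u i ≠ 0 := by
  unfold gsgn; split_ifs <;> norm_num

theorem IX_swap (hq0 : q ≠ 0) (hq1 : ∀ k : ℕ, k ≠ 0 → q ^ k ≠ 1) (pl : Bool) (x y)
    (hx : x ∈ ISet q M N pl) (hy : y ∈ XSet q M N (!pl)) :
    ∃ c : ℂ, c ≠ 0 ∧ x * y = c • (y * x) := by
  obtain ⟨k, u, m, n, h, rfl⟩ := hx
  obtain ⟨i, p, rfl⟩ := hy
  by_cases hi : InR M N i
  · refine ⟨gsgn M k u i, gsgn_ne _ _ _, sub_eq_zero.mp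
      (IElt_bracket hq0 hq1 pl ⟨h.1, ?_⟩ ⟨?_, h.2.2⟩ hi p m n)⟩ <;> omega
  · refine ⟨1, one_ne_zero, ?_⟩
    rw [XA_out (!pl) hi]
    simp

theorem IX_le (hq0 : q ≠ 0) (hq1 : ∀ k : ℕ, k ≠ 0 → q ^ k ≠ 1) (pl : Bool) :
    Submodule.span ℂ (ISet q M N pl) * Submodule.span ℂ (XSet q M N (!pl)) ≤
      Submodule.span ℂ (XSet q M N (!pl)) * Submodule.span ℂ (ISet q M N pl) := by
  rw [Submodule.span_mul_span, Submodule.span_le]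
  rintro _ ⟨x, hx, y, hy, rfl⟩
  obtain ⟨c, _, e⟩ := IX_swap hq0 hq1 pl x y hx hy
  simp only [SetLike.mem_coe]
  rw [e]
  exact Submodule.smul_mem _ _ (Submodule.mul_mem_mul (Submodule.subset_span hy)
    (Submodule.subset_span hx))

theorem XI_le (hq0 : q ≠ 0) (hq1 : ∀ k : ℕ, k ≠ 0 → q ^ k ≠ 1) (pl : Bool) :
    Submodule.span ℂ (XSet q M N (!pl)) * Submodule.span ℂ (ISet q M N pl) ≤
      Submodule.span ℂ (ISet q M N pl) * Submodule.span ℂ (XSet q M N (!pl)) := by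
  rw [Submodule.span_mul_span, Submodule.span_le]
  rintro _ ⟨y, hy, x, hx, rfl⟩
  obtain ⟨c, hc, e⟩ := IX_swap hq0 hq1 pl x y hx hy
  have e2 : y * x = c⁻¹ • (x * y) := by
    rw [e, smul_smul, inv_mul_cancel₀ hc, one_smul]
  simp only [SetLike.mem_coe]
  rw [e2]
  exact Submodule.smul_mem _ _ (Submodule.mul_mem_mul (Submodule.subset_span hx)
    (Submodule.subset_span hy))

theorem ideal_of_gens (T : Submodule ℂ (ALG q M N false 1))
    (h : ∀ g, g = Submodule.span ℂ (XSet q M N true) ∨ g = Submodule.span ℂ (ZSet q M N) ∨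
      g = Submodule.span ℂ (XSet q M N false) → T * g ≤ T ∧ g * T ≤ T)
    (y : ALG q M N false 1) : ∀ x ∈ T, x * y ∈ T ∧ y * x ∈ T := by
  obtain ⟨f, rfl⟩ := RingQuot.mkAlgHom_surjective ℂ (rel q M N false 1) y
  change ∀ x ∈ T, x * mkA q M N false 1 f ∈ T ∧ mkA q M N false 1 f * x ∈ T
  have gen : ∀ S : Set (ALG q M N false 1), (T * Submodule.span ℂ S ≤ T ∧
      Submodule.span ℂ S * T ≤ T) → ∀ a ∈ S, ∀ x ∈ T, x * a ∈ T ∧ a * x ∈ T :=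
    fun S hS a ha x hx => ⟨hS.1 (Submodule.mul_mem_mul hx (Submodule.subset_span ha)),
      hS.2 (Submodule.mul_mem_mul (Submodule.subset_span ha) hx)⟩
  induction f using FreeAlgebra.induction with
  | grade0 r =>
    intro x hx
    rw [AlgHom.commutes, ← Algebra.commutes, ← Algebra.smul_def]
    exact ⟨T.smul_mem _ hx, T.smul_mem _ hx⟩
  | grade1 g =>
    change ∀ x ∈ T, x * mkA q M N false 1 (gi g) ∈ T ∧ mkA q M N false 1 (gi g) * x ∈ T
    cases g with
    | Xp i n => exact gen _ (h _ (Or.inl rfl)) _ ⟨i.1, n, (XA_true_in i.2 n).symm⟩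
    | Xm i n => exact gen _ (h _ (Or.inr (Or.inr rfl))) _ ⟨i.1, n, (XA_false_in i.2 n).symm⟩
    | K i => exact gen _ (h _ (Or.inr (Or.inl rfl))) _ (Or.inl ⟨i.1, (KA_in i.2).symm⟩)
    | Ki i => exact gen _ (h _ (Or.inr (Or.inl rfl))) _ (Or.inr (Or.inl ⟨i.1, (KiA_in i.2).symm⟩))
    | H i s =>
      exact gen _ (h _ (Or.inr (Or.inl rfl))) _
        (Or.inr (Or.inr ⟨i.1, s.1, (HA_in i.2 s.2).symm⟩))
    | K0 e => exact absurd e Bool.false_ne_true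
    | K0i e => exact absurd e Bool.false_ne_true
  | mul a b ha hb =>
    intro x hx
    rw [map_mul, ← mul_assoc x, mul_assoc _ _ x]
    exact ⟨(hb _ (ha x hx).1).1, (ha _ (hb x hx).2).2⟩
  | add a b ha hb =>
    intro x hx
    rw [map_add, mul_add, add_mul]
    exact ⟨T.add_mem (ha x hx).1 (hb x hx).1, T.add_mem (ha x hx).2 (hb x hx).2⟩

theorem Tplus6_ideal (hq0 : q ≠ 0) (hq1 : ∀ k : ℕ, k ≠ 0 → q ^ k ≠ 1)
    (y : ALG q M N false 1) : ∀ x ∈ Tplus6 q M N, x * y ∈ Tplus6 q M N ∧ y * x ∈ Tplus6 q M N := by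
  refine ideal_of_gens _ (fun g hg => ?_) y
  unfold Tplus6
  rw [IsubAll_eq]
  exact star_Tplus (isStar_adjoin (XSet q M N true)) (isStar_adjoin (ZSet q M N))
    (isStar_adjoin (XSet q M N false)) (swap_span _ _ (X_swap hq0 true)).1
    (swap_span _ _ (X_swap hq0 false)).2 PM_le (swap_span _ _ (I_swap hq0 true)).1
    (IX_le hq0 hq1 true) hg

theorem Tminus6_ideal (hq0 : q ≠ 0) (hq1 : ∀ k : ℕ, k ≠ 0 → q ^ k ≠ 1)
    (y : ALG q M N false 1) :
    ∀ x ∈ Tminus6 q M N, x * y ∈ Tminus6 q M N ∧ y * x ∈ Tminus6 q M N := by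
  refine ideal_of_gens _ (fun g hg => ?_) y
  unfold Tminus6
  rw [IsubAll_eq]
  exact star_Tminus (isStar_adjoin (XSet q M N true)) (isStar_adjoin (ZSet q M N))
    (isStar_adjoin (XSet q M N false)) (swap_span _ _ (X_swap hq0 true)).1
    (swap_span _ _ (X_swap hq0 false)).2 PM_le (swap_span _ _ (I_swap hq0 false)).2
    (XI_le hq0 hq1 false) hg

end Ideals
end QAS

open QAS in
/-- in `Ṽ` (relations (R1)–(R3) only), the graded commutator of every
element of `I^±_{k,u}` with `X^∓_{i,0}` vanishes; consequently `Ṽ⁻Ṽ⁰Ṽ⁺I⁺Ṽ⁺` and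
`Ṽ⁻I⁻Ṽ⁻Ṽ⁰Ṽ⁺` are two-sided ideals of `Ṽ`. -/
theorem Irels_triangular (q : ℂ) (hq0 : q ≠ 0)
    (hq1 : ∀ k : ℕ, k ≠ 0 → q ^ k ≠ 1) (M N : ℕ) (hM : 1 ≤ M) (hN : 1 ≤ N) :
    (∀ k u i : ℕ, 1 ≤ k → k ≤ u → u ≤ M + N - 1 → 1 ≤ i → i ≤ M + N - 1 →
      (∀ x ∈ Isub q M N false 1 true k u,
        x * XmA q M N false 1 i 0 - gsgn M k u i • (XmA q M N false 1 i 0 * x) = 0) ∧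
      (∀ x ∈ Isub q M N false 1 false k u,
        x * XpA q M N false 1 i 0 - gsgn M k u i • (XpA q M N false 1 i 0 * x) = 0)) ∧
    (∀ x ∈ Tplus6 q M N, ∀ y : ALG q M N false 1,
      x * y ∈ Tplus6 q M N ∧ y * x ∈ Tplus6 q M N) ∧
    (∀ x ∈ Tminus6 q M N, ∀ y : ALG q M N false 1,
      x * y ∈ Tminus6 q M N ∧ y * x ∈ Tminus6 q M N) := by
  refine ⟨?_, fun x hx y => Tplus6_ideal hq0 hq1 y x hx,
    fun x hx y => Tminus6_ideal hq0 hq1 y x hx⟩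
  intro k u i hk hku hu hi hi'
  have h1 : InR M N k := ⟨hk, by omega⟩
  have h2 : InR M N u := ⟨by omega, hu⟩
  exact ⟨fun x hx => Isub_bracket hq0 hq1 true h1 h2 ⟨hi, hi'⟩ 0 x hx,
    fun x hx => Isub_bracket hq0 hq1 false h1 h2 ⟨hi, hi'⟩ 0 x hx⟩
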